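/- Let ε > 0 and let φ : ℝⁿ → ℝ be smooth with Hess φ(x) − ε·Id positive semidefinite for every x ∈ ℝⁿ. Let 1 ≤ p ≤ n and let β = Σ_{|I|=p} β_I dx_I ∧ dξ_1∧…∧dξ_n be a (p,n)-super form with locally integrable coefficients such that Σ_{|I|=p} ∫_{ℝⁿ} β_I² e^{−φ} dx < ∞ and dβ = 0 in the sense of distributions. Then there exists a (p−1,n)-super form α = Σ_{|K|=p−1} α_K dx_K ∧ dξ_1∧…∧dξ_n with locally integrable coefficients such that dα = β in the sense of distributions and Σ_{|K|=p−1} ∫_{ℝⁿ} α_K² e^{−φ} dx ≤ (pε)⁻¹ Σ_{|I|=p} ∫_{ℝⁿ} β_I² e^{−φ} dx. -/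

import Mathlib

open scoped BigOperators
open MeasureTheory

noncomputable section

/-- A (coefficient) family defining a form on `ℝⁿ`: for each subset `L ⊆ {1,…,n}` a
function on `ℝⁿ` (only the values on `|L| = p` matter for a `p`-form
`β = Σ_{|L|=p} β_L dx_L`). -/
abbrev Coef (n : ℕ) := Finset (Fin n) → (Fin n → ℝ) → ℝ

/-- `IsDistDeriv n p α β` says the `p`-form `α` satisfies `dα = β` in the sense of
distributions: for every `M` with `|M| = p+1` and every smooth compactly supported test
function `χ`, `∫ β_M χ = −Σ_{i∈M} (−1)^{#{j∈M : j<i}} ∫ α_{M∖{i}} ∂χ/∂x_i`. -/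
def IsDistDeriv (n p : ℕ) (α β : Coef n) : Prop :=
  ∀ M : Finset (Fin n), M.card = p + 1 →
    ∀ χ : (Fin n → ℝ) → ℝ, ContDiff ℝ (⊤ : ℕ∞) χ → HasCompactSupport χ →
      (∫ x : Fin n → ℝ, β M x * χ x) =
        -∑ i ∈ M, (-1 : ℝ) ^ (M.filter (· < i)).card *
            ∫ x : Fin n → ℝ, α (M.erase i) x * fderiv ℝ χ x (Pi.single i 1)

/-- The Hessian matrix `(∂²φ/∂x_i∂x_j)` of `φ : ℝⁿ → ℝ`. -/
def hessM (n : ℕ) (φ : (Fin n → ℝ) → ℝ) (x : Fin n → ℝ) : Matrix (Fin n) (Fin n) ℝ :=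
  Matrix.of fun i j => fderiv ℝ (fun y => fderiv ℝ φ y (Pi.single j 1)) x (Pi.single i 1)

/-- The `p×p` minor of a matrix with rows indexed by `L` and columns by `L'`
(both enumerated increasingly); `0` if `L` or `L'` does not have cardinality `p`. -/
def minorDet (n p : ℕ) (M : Matrix (Fin n) (Fin n) ℝ) (L L' : Finset (Fin n)) : ℝ :=
  if h : L.card = p ∧ L'.card = p then
    Matrix.det (Matrix.of fun i j : Fin p => M (L.orderEmbOfFin h.1 i) (L'.orderEmbOfFin h.2 j))
  else 0

/-- The pointwise squared norm of the `p`-form `β` with respect to the metric `g`: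
`|β|²_g(x) = Σ_{L,L'} β_L(x) β_{L'}(x) det[(g(x)⁻¹)_{L,L'}]`. -/
def normSqG (n p : ℕ) (g : (Fin n → ℝ) → Matrix (Fin n) (Fin n) ℝ) (β : Coef n)
    (x : Fin n → ℝ) : ℝ :=
  ∑ L ∈ Finset.univ.filter (fun L : Finset (Fin n) => L.card = p),
    ∑ L' ∈ Finset.univ.filter (fun L' : Finset (Fin n) => L'.card = p),
      β L x * β L' x * minorDet n p ((g x)⁻¹) L L'

/-- The gradient `∇φ`. -/
def gradV (n : ℕ) (φ : (Fin n → ℝ) → ℝ) (x : Fin n → ℝ) : Fin n → ℝ :=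
  fun i => fderiv ℝ φ x (Pi.single i 1)

/-- The Jacobian matrix `(∂ψ_i/∂x_j)` of `ψ : ℝⁿ → ℝⁿ`. -/
def jacM (n : ℕ) (ψ : (Fin n → ℝ) → (Fin n → ℝ)) (x : Fin n → ℝ) :
    Matrix (Fin n) (Fin n) ℝ :=
  Matrix.of fun i j => fderiv ℝ (fun y => ψ y i) x (Pi.single j 1)

/-- The pullback `ψ*α = Σ_{|L|=p} (α_L∘ψ) dψ_{l_1}∧…∧dψ_{l_p}` of a `p`-form, written in
coordinates: its coefficient on `dx_K` is `Σ_L α_L(ψ x) · det[(∂ψ_{l_i}/∂x_{k_j})]`. -/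
def pullb (n p : ℕ) (ψ : (Fin n → ℝ) → (Fin n → ℝ)) (α : Coef n) : Coef n :=
  fun K x =>
    ∑ L ∈ Finset.univ.filter (fun L : Finset (Fin n) => L.card = p),
      α L (ψ x) * minorDet n p (jacM n ψ x) L K

/-- The Legendre transform `φ*(y) = sup_x (x·y − φ(x))`. -/
def legendre (n : ℕ) (φ : (Fin n → ℝ) → ℝ) (y : Fin n → ℝ) : ℝ :=
  ⨆ x : Fin n → ℝ, (∑ i, x i * y i - φ x)

section

/-! ### Exterior algebra combinatorics -/

def sg {n : ℕ} (i : Fin n) (M : Finset (Fin n)) : ℝ := (-1 : ℝ) ^ (M.filter (· < i)).card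

/-- coefficient of exterior multiplication by `dx_i` -/
def ce {n : ℕ} (i : Fin n) (M : Finset (Fin n)) : ℝ := if i ∈ M then sg i M else 0

/-- coefficient of contraction by `∂_i` -/
def ca {n : ℕ} (i : Fin n) (K : Finset (Fin n)) : ℝ := if i ∈ K then 0 else sg i K

lemma sg_sq {n : ℕ} (i : Fin n) (M : Finset (Fin n)) : sg i M * sg i M = 1 := by
  unfold sg
  rw [← pow_add, ← two_mul, pow_mul]; norm_num

lemma sg_insert_self {n : ℕ} (i : Fin n) (M : Finset (Fin n)) : sg i (insert i M) = sg i M := by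
  unfold sg
  congr 2
  ext k
  simp only [Finset.mem_filter, Finset.mem_insert]
  constructor
  · rintro ⟨h | h, h'⟩
    · subst h; exact absurd h' (lt_irrefl _)
    · exact ⟨h, h'⟩
  · rintro ⟨h, h'⟩; exact ⟨Or.inr h, h'⟩

lemma sg_insert {n : ℕ} (i j : Fin n) (M : Finset (Fin n)) (hj : j ∉ M) :
    sg i (insert j M) = if j < i then - sg i M else sg i M := by
  unfold sg
  rw [Finset.filter_insert]
  split_ifs with h
  · rw [Finset.card_insert_of_notMem (by simp [hj]), pow_succ]; ring
  · rfl

lemma sum_reindex {n : ℕ} (i : Fin n) (f : Finset (Fin n) → ℝ) :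
    (∑ M : Finset (Fin n), if i ∈ M then f M else 0)
      = ∑ K : Finset (Fin n), if i ∈ K then 0 else f (insert i K) := by
  have h2 : ∀ K : Finset (Fin n), (if i ∈ K then 0 else f (insert i K))
      = if i ∉ K then f (insert i K) else 0 := by
    intro K; by_cases h : i ∈ K <;> simp [h]
  simp_rw [h2]
  rw [← Finset.sum_filter, ← Finset.sum_filter]
  refine Finset.sum_nbij' (fun M => M.erase i) (fun K => insert i K) ?_ ?_ ?_ ?_ ?_
  · intro M hM; simp
  · intro M hM; simp
  · intro M hM; simp at hM; simp [Finset.insert_erase hM]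
  · intro M hM; simp at hM; simp [Finset.erase_insert hM]
  · intro M hM; simp at hM; simp [Finset.insert_erase hM]

lemma ce_adj {n : ℕ} (i : Fin n) (F G : Finset (Fin n) → ℝ) :
    ∑ M, (ce i M * F (M.erase i)) * G M = ∑ K, F K * (ca i K * G (insert i K)) := by
  have := sum_reindex i (fun M => sg i M * F (M.erase i) * G M)
  calc _ = ∑ M : Finset (Fin n), if i ∈ M then sg i M * F (M.erase i) * G M else 0 := by
        refine Finset.sum_congr rfl fun M _ => ?_
        unfold ce; split_ifs <;> simp
    _ = _ := by
        rw [this]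
        refine Finset.sum_congr rfl fun M _ => ?_
        unfold ca; split_ifs with h
        · simp
        · rw [sg_insert_self, Finset.erase_insert h]; ring

lemma ca_insert_ce {n : ℕ} (i j : Fin n) (hij : i ≠ j) (K : Finset (Fin n)) :
    ca i K * ce j (insert i K) = - (ce j K * ca i (K.erase j)) := by
  by_cases hi : i ∈ K
  · simp [ca, ce, hi, hij]
  by_cases hj : j ∈ K
  · have e : K = insert j (K.erase j) := (Finset.insert_erase hj).symm
    have h1 : sg j (insert i K) = if i < j then - sg j K else sg j K := sg_insert j i K hi
    have h2 : sg i K = if j < i then - sg i (K.erase j) else sg i (K.erase j) := by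
      conv_lhs => rw [e]
      exact sg_insert i j _ (by simp)
    simp only [ca, ce, hi, hj, if_false, if_true, Finset.mem_insert, or_true, Finset.mem_erase,
      and_false]
    rcases lt_or_gt_of_ne hij with h | h
    · rw [h1, h2, if_pos h, if_neg (not_lt.2 h.le)]; ring
    · rw [h1, h2, if_pos h, if_neg (not_lt.2 h.le)]; ring
  · simp [ca, ce, hi, hj, hij.symm]

lemma car {n : ℕ} (i j : Fin n) (F G : Finset (Fin n) → ℝ) :
    ∑ M, (ce i M * F (M.erase i)) * (ce j M * G (M.erase j))
      + ∑ K, (ca j K * F (insert j K)) * (ca i K * G (insert i K))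
      = if i = j then ∑ I, F I * G I else 0 := by
  have h1 := ce_adj i F (fun M => ce j M * G (M.erase j))
  have h2 := ce_adj j (fun K => ca i K * G (insert i K)) F
  have h2' : ∑ K, (ca j K * F (insert j K)) * (ca i K * G (insert i K))
     = ∑ M, F M * (ce j M * (ca i (M.erase j) * G (insert i (M.erase j)))) := by
    rw [← Finset.sum_congr rfl (fun K _ => mul_comm _ _), ← h2]
    refine Finset.sum_congr rfl fun M _ => ?_
    ring
  rw [h1, h2', ← Finset.sum_add_distrib]
  split_ifs with hij
  · subst hij
    refine Finset.sum_congr rfl fun K _ => ?_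
    by_cases h : i ∈ K
    · have := sg_sq i K
      have h3 : sg i (K.erase i) = sg i K := by
        conv_rhs => rw [← Finset.insert_erase h, sg_insert_self]
      simp [ca, ce, h, Finset.insert_erase h, h3, ← mul_assoc]
      rw [mul_assoc (F K), this]; simp
    · have := sg_sq i K
      simp [ca, ce, h, sg_insert_self, Finset.erase_insert h, ← mul_assoc]
      rw [mul_assoc (F K), this]; simp
  · refine Finset.sum_eq_zero fun K _ => ?_
    by_cases hj : j ∈ K
    · have e : (insert i K).erase j = insert i (K.erase j) := by
        rw [Finset.erase_insert_of_ne hij]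
      have := ca_insert_ce i j hij K
      rw [e]
      linear_combination (F K * G (insert i (K.erase j))) * this
    · have : j ∉ insert i K := by simp [hj, Ne.symm hij]
      simp [ce, hj, this]

lemma ca_sq_sum {n : ℕ} (F : Finset (Fin n) → ℝ) :
    ∑ K, ∑ i, (ca i K * F (insert i K)) ^ 2 = ∑ I : Finset (Fin n), (I.card : ℝ) * F I ^ 2 := by
  rw [Finset.sum_comm]
  have : ∀ i : Fin n, ∑ K, (ca i K * F (insert i K)) ^ 2
      = ∑ M : Finset (Fin n), if i ∈ M then F M ^ 2 else 0 := by
    intro i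
    rw [sum_reindex i (fun M => F M ^ 2)]
    refine Finset.sum_congr rfl fun K _ => ?_
    unfold ca; split_ifs
    · simp
    · rw [mul_pow, pow_two (sg i K), sg_sq, one_mul]
  simp_rw [this]
  rw [Finset.sum_comm]
  refine Finset.sum_congr rfl fun M _ => ?_
  rw [← Finset.sum_filter]
  simp

lemma ce_anti {n : ℕ} (M : Finset (Fin n)) (S : Fin n → Fin n → Finset (Fin n) → ℝ)
    (hS : ∀ i j K, S i j K = S j i K) :
    ∑ j, ∑ i, ce j M * (ce i (M.erase j) * S j i ((M.erase j).erase i)) = 0 := by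
  have key : ∀ i j, ce j M * (ce i (M.erase j) * S j i ((M.erase j).erase i))
      = - (ce i M * (ce j (M.erase i) * S i j ((M.erase i).erase j))) := by
    intro i j
    by_cases hij : i = j
    · subst hij; simp [ce]
    by_cases hi : i ∈ M
    · by_cases hj : j ∈ M
      · have e1 := sg_insert j i (M.erase i) (by simp)
        have e2 := sg_insert i j (M.erase j) (by simp)
        rw [Finset.insert_erase hi] at e1
        rw [Finset.insert_erase hj] at e2
        rw [Finset.erase_right_comm (a := i) (b := j), hS i j]
        simp only [ce, hi, hj, Finset.mem_erase, if_true, and_true, hij, Ne.symm hij, ne_eq,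
          not_false_eq_true]
        rcases lt_or_gt_of_ne hij with h | h
        · rw [e1, e2, if_pos h, if_neg (not_lt.2 h.le)]; ring
        · rw [e1, e2, if_pos h, if_neg (not_lt.2 h.le)]; ring
      · simp [ce, hj]
    · simp [ce, hi]
  have h := Finset.sum_comm (s := Finset.univ) (t := Finset.univ)
    (f := fun j i => ce j M * (ce i (M.erase j) * S j i ((M.erase j).erase i)))
  have h2 : ∑ j, ∑ i, ce j M * (ce i (M.erase j) * S j i ((M.erase j).erase i))
     = - ∑ j, ∑ i, ce j M * (ce i (M.erase j) * S j i ((M.erase j).erase i)) := by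
    conv_lhs => rw [h]
    rw [← Finset.sum_neg_distrib]
    refine Finset.sum_congr rfl fun i _ => ?_
    rw [← Finset.sum_neg_distrib]
    refine Finset.sum_congr rfl fun j _ => ?_
    exact key i j
  linarith

/-- pointwise expansion of `|dη|²`. -/
lemma d_sq {n : ℕ} (X : Fin n → Finset (Fin n) → ℝ) :
    ∑ M, (∑ i, ce i M * X i (M.erase i)) ^ 2
      + ∑ K, ∑ i, ∑ j, (ca j K * X i (insert j K)) * (ca i K * X j (insert i K))
      = ∑ i, ∑ I, X i I ^ 2 := by
  have h1 : ∑ M, (∑ i, ce i M * X i (M.erase i)) ^ 2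
      = ∑ i, ∑ j, ∑ M, (ce i M * X i (M.erase i)) * (ce j M * X j (M.erase j)) := by
    simp_rw [pow_two, Finset.sum_mul_sum]
    rw [Finset.sum_comm]
    refine Finset.sum_congr rfl fun i _ => ?_
    rw [Finset.sum_comm]
  have h2 : ∑ K, ∑ i, ∑ j, (ca j K * X i (insert j K)) * (ca i K * X j (insert i K))
      = ∑ i, ∑ j, ∑ K, (ca j K * X i (insert j K)) * (ca i K * X j (insert i K)) := by
    rw [Finset.sum_comm]
    refine Finset.sum_congr rfl fun i _ => ?_
    rw [Finset.sum_comm]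
  rw [h1, h2, ← Finset.sum_add_distrib]
  refine Finset.sum_congr rfl fun i _ => ?_
  rw [← Finset.sum_add_distrib]
  simp_rw [car]
  simp [pow_two]

end

section

/-! ### Test functions and first order operators -/

def Tst {n : ℕ} (f : (Fin n → ℝ) → ℝ) : Prop := ContDiff ℝ (⊤ : ℕ∞) f ∧ HasCompactSupport f

def pd {n : ℕ} (i : Fin n) (f : (Fin n → ℝ) → ℝ) (x : Fin n → ℝ) : ℝ :=
  fderiv ℝ f x (Pi.single i 1)

/-- `σ ∂_i + φ_i / 2`. -/
def Bo {n : ℕ} (φ : (Fin n → ℝ) → ℝ) (σ : ℝ) (i : Fin n) (f : (Fin n → ℝ) → ℝ)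
    (x : Fin n → ℝ) : ℝ := σ * pd i f x + pd i φ x / 2 * f x

variable {n : ℕ}

lemma smooth_pd {f : (Fin n → ℝ) → ℝ} (hf : ContDiff ℝ (⊤ : ℕ∞) f) (i : Fin n) :
    ContDiff ℝ (⊤ : ℕ∞) (pd i f) := by
  have h : ContDiff ℝ (⊤ : ℕ∞) (fderiv ℝ f) := hf.fderiv_right (by simp)
  exact h.clm_apply contDiff_const

lemma smooth_diff {f : (Fin n → ℝ) → ℝ} (hf : ContDiff ℝ (⊤ : ℕ∞) f) (x : Fin n → ℝ) :
    DifferentiableAt ℝ f x := (hf.differentiable (by simp)).differentiableAt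

lemma Tst.pd {f : (Fin n → ℝ) → ℝ} (hf : Tst f) (i : Fin n) : Tst (pd i f) :=
  ⟨smooth_pd hf.1 i, hf.2.fderiv_apply ℝ _⟩

lemma Tst.mul {f g : (Fin n → ℝ) → ℝ} (hg : ContDiff ℝ (⊤ : ℕ∞) g) (hf : Tst f) :
    Tst (fun x => g x * f x) :=
  ⟨hg.mul hf.1, hf.2.mul_left⟩

lemma Tst.add {f g : (Fin n → ℝ) → ℝ} (hf : Tst f) (hg : Tst g) :
    Tst (fun x => f x + g x) :=
  ⟨hf.1.add hg.1, hf.2.add hg.2⟩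

lemma Tst.zero : Tst (fun _ : Fin n → ℝ => (0 : ℝ)) :=
  ⟨contDiff_const, HasCompactSupport.zero⟩

lemma Tst.const_mul {f : (Fin n → ℝ) → ℝ} (c : ℝ) (hf : Tst f) :
    Tst (fun x => c * f x) := Tst.mul contDiff_const hf

lemma Tst.sum {ι : Type*} (s : Finset ι) {f : ι → (Fin n → ℝ) → ℝ} (hf : ∀ i, Tst (f i)) :
    Tst (fun x => ∑ i ∈ s, f i x) := by
  classical
  induction s using Finset.induction_on with
  | empty => simpa using Tst.zero
  | insert a s ha ih =>
    simp_rw [Finset.sum_insert ha]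
    exact (hf a).add ih

lemma Tst.Bo {φ f : (Fin n → ℝ) → ℝ} (hφ : ContDiff ℝ (⊤ : ℕ∞) φ) (hf : Tst f) (σ : ℝ)
    (i : Fin n) : Tst (Bo φ σ i f) :=
  ((hf.pd i).const_mul σ).add (Tst.mul ((smooth_pd hφ i).div_const 2) hf)

lemma Tst.integrable {f : (Fin n → ℝ) → ℝ} (hf : Tst f) : Integrable f :=
  hf.1.continuous.integrable_of_hasCompactSupport hf.2

lemma Tst.memLp {f : (Fin n → ℝ) → ℝ} (hf : Tst f) : MemLp f 2 :=
  hf.1.continuous.memLp_of_hasCompactSupport hf.2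

lemma pd_mul {f g : (Fin n → ℝ) → ℝ} (hf : ContDiff ℝ (⊤ : ℕ∞) f) (hg : ContDiff ℝ (⊤ : ℕ∞) g)
    (i : Fin n) (x : Fin n → ℝ) :
    pd i (fun x => f x * g x) x = f x * pd i g x + pd i f x * g x := by
  unfold pd
  have : (fun x => f x * g x) = f * g := rfl
  rw [this, fderiv_mul (smooth_diff hf x) (smooth_diff hg x)]
  simp; ring

lemma pd_add {f g : (Fin n → ℝ) → ℝ} (hf : ContDiff ℝ (⊤ : ℕ∞) f) (hg : ContDiff ℝ (⊤ : ℕ∞) g)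
    (i : Fin n) (x : Fin n → ℝ) :
    pd i (fun x => f x + g x) x = pd i f x + pd i g x := by
  unfold pd
  have : (fun x => f x + g x) = f + g := rfl
  rw [this, fderiv_add (smooth_diff hf x) (smooth_diff hg x)]
  simp

lemma pd_const_mul {f : (Fin n → ℝ) → ℝ} (hf : ContDiff ℝ (⊤ : ℕ∞) f) (c : ℝ)
    (i : Fin n) (x : Fin n → ℝ) :
    pd i (fun x => c * f x) x = c * pd i f x := by
  rw [pd_mul contDiff_const hf]; simp [pd]

lemma pd_comm {f : (Fin n → ℝ) → ℝ} (hf : ContDiff ℝ (⊤ : ℕ∞) f) (i j : Fin n) (x : Fin n → ℝ) :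
    pd i (pd j f) x = pd j (pd i f) x := by
  have hd : DifferentiableAt ℝ (fderiv ℝ f) x :=
    ((hf.fderiv_right (m := (⊤ : ℕ∞)) (by simp)).differentiable (by simp)).differentiableAt
  have key : ∀ a b : Fin n, pd a (pd b f) x
      = fderiv ℝ (fderiv ℝ f) x (Pi.single a 1) (Pi.single b 1) := by
    intro a b
    unfold pd
    rw [fderiv_clm_apply hd (differentiableAt_const _)]
    simp
  rw [key, key]
  have : IsSymmSndFDerivAt ℝ f x := hf.contDiffAt.isSymmSndFDerivAt (by
    simp only [minSmoothness_of_isRCLikeNormedField]; 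
    exact WithTop.coe_le_coe.2 (le_top : (2 : ℕ∞) ≤ ⊤))
  exact this _ _

lemma ibp {f g : (Fin n → ℝ) → ℝ} (hf : Tst f) (hg : ContDiff ℝ (⊤ : ℕ∞) g) (i : Fin n) :
    ∫ x, pd i f x * g x = - ∫ x, f x * pd i g x := by
  have h1 : Integrable (fun x => pd i f x * g x) := by
    have := (Tst.mul hg (hf.pd i)).integrable
    simpa [mul_comm] using this
  have h2 : Integrable (fun x => f x * pd i g x) := by
    have := (Tst.mul (smooth_pd hg i) hf).integrable
    simpa [mul_comm] using this
  have h3 : Integrable (fun x => f x * g x) := by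
    have := (Tst.mul hg hf).integrable
    simpa [mul_comm] using this
  have := integral_mul_fderiv_eq_neg_fderiv_mul_of_integrable (v := Pi.single i 1) h1 h2 h3
    (fun x _ => smooth_diff hf.1 x) (fun x _ => smooth_diff hg x)
  simp only [pd] at *
  linarith

lemma Tst.mul' {f g : (Fin n → ℝ) → ℝ} (hf : Tst f) (hg : Tst g) :
    Tst (fun x => f x * g x) := Tst.mul hf.1 hg

lemma Bo_adj {φ f g : (Fin n → ℝ) → ℝ} (hφ : ContDiff ℝ (⊤ : ℕ∞) φ) (hf : Tst f) (hg : Tst g)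
    (σ : ℝ) (i : Fin n) :
    ∫ x, Bo φ σ i f x * g x = ∫ x, f x * Bo φ (-σ) i g x := by
  have h := ibp hf hg.1 i
  have e1 : ∀ x, Bo φ σ i f x * g x = σ * (pd i f x * g x) + pd i φ x / 2 * (f x * g x) := by
    intro x; unfold Bo; ring
  have e2 : ∀ x, f x * Bo φ (-σ) i g x
      = (-σ) * (f x * pd i g x) + pd i φ x / 2 * (f x * g x) := by
    intro x; unfold Bo; ring
  have i3 := (Tst.mul ((smooth_pd hφ i).div_const 2) (hf.mul' hg)).integrable
  simp_rw [e1, e2]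
  rw [integral_add (((hf.pd i).mul' hg).const_mul σ).integrable i3,
    integral_add ((hf.mul' (hg.pd i)).const_mul (-σ)).integrable i3,
    integral_const_mul, integral_const_mul, h]
  ring

lemma pd_Bo {φ f : (Fin n → ℝ) → ℝ} (hφ : ContDiff ℝ (⊤ : ℕ∞) φ) (hf : ContDiff ℝ (⊤ : ℕ∞) f)
    (σ : ℝ) (i j : Fin n) (x : Fin n → ℝ) :
    pd j (Bo φ σ i f) x = σ * pd j (pd i f) x + pd i φ x / 2 * pd j f x
      + pd j (pd i φ) x / 2 * f x := by
  have h1 := smooth_pd hf i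
  have h2 : ContDiff ℝ (⊤ : ℕ∞) (fun x => pd i φ x / 2) := (smooth_pd hφ i).div_const 2
  have e : pd j (fun x => pd i φ x / 2) x = pd j (pd i φ) x / 2 := by
    have := pd_const_mul (smooth_pd hφ i) (1/2) j x
    simp_rw [div_eq_inv_mul] at *
    simpa using this
  have : Bo φ σ i f = fun x => (fun x => σ * pd i f x) x + (fun x => pd i φ x / 2 * f x) x := rfl
  rw [this, pd_add (contDiff_const.mul h1) (h2.mul hf), pd_const_mul h1, pd_mul h2 hf, e]
  ring

lemma Bo_comm {φ f : (Fin n → ℝ) → ℝ} (hφ : ContDiff ℝ (⊤ : ℕ∞) φ) (hf : ContDiff ℝ (⊤ : ℕ∞) f)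
    (i j : Fin n) (x : Fin n → ℝ) :
    Bo φ 1 i (Bo φ (-1) j f) x = Bo φ (-1) j (Bo φ 1 i f) x + pd i (pd j φ) x * f x := by
  have h1 := pd_Bo hφ hf (-1) j i x
  have h2 := pd_Bo hφ hf 1 i j x
  rw [pd_comm hf j i, pd_comm hφ j i] at h2
  rw [Bo, h1, Bo, Bo, h2, Bo]; ring

lemma Bo_comm' {φ f : (Fin n → ℝ) → ℝ} (hφ : ContDiff ℝ (⊤ : ℕ∞) φ) (hf : ContDiff ℝ (⊤ : ℕ∞) f)
    (i j : Fin n) (x : Fin n → ℝ) :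
    Bo φ 1 i (Bo φ 1 j f) x = Bo φ 1 j (Bo φ 1 i f) x := by
  have h1 := pd_Bo hφ hf 1 j i x
  have h2 := pd_Bo hφ hf 1 i j x
  rw [pd_comm hf j i, pd_comm hφ j i] at h2
  rw [Bo, h1, Bo, Bo, h2, Bo]; ring

lemma Bo_scalar {φ f g : (Fin n → ℝ) → ℝ} (hφ : ContDiff ℝ (⊤ : ℕ∞) φ) (hf : Tst f) (hg : Tst g)
    (i j : Fin n) :
    ∫ x, Bo φ (-1) i f x * Bo φ (-1) j g x
      = ∫ x, Bo φ 1 j f x * Bo φ 1 i g x + pd i (pd j φ) x * (f x * g x) := by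
  rw [Bo_adj hφ hf (hg.Bo hφ _ _)]
  have h := Bo_adj hφ hf (hg.Bo hφ 1 i) 1 j
  have i2 := (Tst.mul (smooth_pd (smooth_pd hφ j) i) (hf.mul' hg)).integrable
  rw [integral_add ((hf.Bo hφ _ _).mul' (hg.Bo hφ _ _)).integrable i2, h,
    ← integral_add (hf.mul' ((hg.Bo hφ _ _).Bo hφ _ _)).integrable i2]
  congr 1
  ext x
  rw [neg_neg, Bo_comm hφ hg.1]
  ring

lemma Bo_const_mul {φ f : (Fin n → ℝ) → ℝ} (hf : ContDiff ℝ (⊤ : ℕ∞) f) (σ c : ℝ) (i : Fin n)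
    (x : Fin n → ℝ) : Bo φ σ i (fun y => c * f y) x = c * Bo φ σ i f x := by
  unfold Bo; rw [pd_const_mul hf]; ring

lemma Bo_add {φ f g : (Fin n → ℝ) → ℝ} (hf : ContDiff ℝ (⊤ : ℕ∞) f)
    (hg : ContDiff ℝ (⊤ : ℕ∞) g) (σ : ℝ) (i : Fin n)
    (x : Fin n → ℝ) : Bo φ σ i (fun y => f y + g y) x = Bo φ σ i f x + Bo φ σ i g x := by
  unfold Bo; rw [pd_add hf hg]; ring

/-- twisted exterior derivative -/
def Dd (φ : (Fin n → ℝ) → ℝ) (η : Coef n) : Coef n :=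
  fun M x => ∑ i, ce i M * Bo φ 1 i (η (M.erase i)) x

/-- twisted codifferential -/
def Ds (φ : (Fin n → ℝ) → ℝ) (η : Coef n) : Coef n :=
  fun K x => ∑ i, ca i K * Bo φ (-1) i (η (insert i K)) x

lemma Tst.Dd {φ : (Fin n → ℝ) → ℝ} (hφ : ContDiff ℝ (⊤ : ℕ∞) φ) {η : Coef n}
    (h : ∀ I, Tst (η I)) (M : Finset (Fin n)) : Tst (Dd φ η M) :=
  Tst.sum _ fun i => ((h _).Bo hφ _ _).const_mul _

lemma Tst.Ds {φ : (Fin n → ℝ) → ℝ} (hφ : ContDiff ℝ (⊤ : ℕ∞) φ) {η : Coef n}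
    (h : ∀ I, Tst (η I)) (M : Finset (Fin n)) : Tst (Ds φ η M) :=
  Tst.sum _ fun i => ((h _).Bo hφ _ _).const_mul _

lemma Tst.sq {f : (Fin n → ℝ) → ℝ} (hf : Tst f) : Tst (fun x => f x ^ 2) := by
  simpa [pow_two] using hf.mul' hf

lemma Ds_sq {φ : (Fin n → ℝ) → ℝ} (hφ : ContDiff ℝ (⊤ : ℕ∞) φ) {η : Coef n}
    (h : ∀ I, Tst (η I)) (K : Finset (Fin n)) :
    ∫ x, Ds φ η K x ^ 2 = ∫ x, (∑ i, ∑ j, (ca j K * Bo φ 1 i (η (insert j K)) x)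
        * (ca i K * Bo φ 1 j (η (insert i K)) x)
      + ∑ i, ∑ j, pd i (pd j φ) x * ((ca i K * η (insert i K) x) * (ca j K * η (insert j K) x))) := by
  have T : ∀ i j, Tst (fun x => Bo φ 1 j (fun y => ca i K * η (insert i K) y) x
        * Bo φ 1 i (fun y => ca j K * η (insert j K) y) x
      + pd i (pd j φ) x * ((ca i K * η (insert i K) x) * (ca j K * η (insert j K) x))) := by
    intro i j
    exact ((((h _).const_mul _).Bo hφ _ _).mul' (((h _).const_mul _).Bo hφ _ _)).add
      (Tst.mul (smooth_pd (smooth_pd hφ j) i) (((h _).const_mul _).mul' ((h _).const_mul _)))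
  have T2 : ∀ i j, Tst (fun x => Bo φ (-1) i (fun y => ca i K * η (insert i K) y) x
      * Bo φ (-1) j (fun y => ca j K * η (insert j K) y) x) := fun i j =>
    (((h _).const_mul _).Bo hφ _ _).mul' (((h _).const_mul _).Bo hφ _ _)
  have e1 : ∀ x, Ds φ η K x ^ 2 = ∑ i, ∑ j, Bo φ (-1) i (fun y => ca i K * η (insert i K) y) x
      * Bo φ (-1) j (fun y => ca j K * η (insert j K) y) x := by
    intro x
    unfold Ds
    rw [pow_two, Finset.sum_mul_sum]
    simp_rw [Bo_const_mul (h _).1]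
  simp_rw [e1]
  rw [integral_finsetSum _ (fun i _ => (Tst.sum _ fun j => T2 i j).integrable)]
  simp_rw [integral_finsetSum _ (fun j _ => (T2 _ j).integrable)]
  simp_rw [Bo_scalar hφ ((h _).const_mul _) ((h _).const_mul _)]
  simp_rw [← integral_finsetSum _ (fun j _ => (T _ j).integrable)]
  rw [← integral_finsetSum _ (fun i _ => (Tst.sum _ fun j => T i j).integrable)]
  congr 1
  ext x
  rw [← Finset.sum_add_distrib]
  refine Finset.sum_congr rfl fun i _ => ?_
  rw [← Finset.sum_add_distrib]
  refine Finset.sum_congr rfl fun j _ => ?_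
  rw [Bo_const_mul (h _).1, Bo_const_mul (h _).1]
  ring

lemma hess_lower (φ : (Fin n → ℝ) → ℝ) (ε : ℝ) (x : Fin n → ℝ)
    (hH : ((hessM n φ x) - ε • (1 : Matrix (Fin n) (Fin n) ℝ)).PosSemidef) (v : Fin n → ℝ) :
    ε * ∑ i, v i ^ 2 ≤ ∑ i, ∑ j, pd i (pd j φ) x * (v i * v j) := by
  have := hH.dotProduct_mulVec_nonneg v
  rw [Matrix.sub_mulVec, dotProduct_sub] at this
  have e1 : star v ⬝ᵥ (hessM n φ x).mulVec v = ∑ i, ∑ j, pd i (pd j φ) x * (v i * v j) := by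
    simp only [dotProduct, Matrix.mulVec, hessM, Matrix.of_apply, Finset.mul_sum]
    refine Finset.sum_congr rfl fun i _ => Finset.sum_congr rfl fun j _ => ?_
    have : pd i (pd j φ) x
      = fderiv ℝ (fun y => fderiv ℝ φ y (Pi.single j 1)) x (Pi.single i 1) := rfl
    rw [this, Pi.star_apply, star_trivial]
    ring
  have e2 : star v ⬝ᵥ (ε • (1 : Matrix (Fin n) (Fin n) ℝ)).mulVec v = ε * ∑ i, v i ^ 2 := by
    rw [Matrix.smul_mulVec, Matrix.one_mulVec, dotProduct_smul]
    simp [dotProduct, pow_two]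
  rw [e1, e2] at this
  linarith

/-- Bochner inequality for test forms. -/
lemma bochner {φ : (Fin n → ℝ) → ℝ} (hφ : ContDiff ℝ (⊤ : ℕ∞) φ) (ε : ℝ)
    (hHess : ∀ x, ((hessM n φ x) - ε • (1 : Matrix (Fin n) (Fin n) ℝ)).PosSemidef)
    {η : Coef n} (h : ∀ I, Tst (η I)) :
    ε * ∑ I : Finset (Fin n), (I.card : ℝ) * ∫ x, η I x ^ 2
      ≤ (∑ M, ∫ x, Dd φ η M x ^ 2) + ∑ K, ∫ x, Ds φ η K x ^ 2 := by
  have TB : ∀ σ i I, Tst (Bo φ σ i (η I)) := fun σ i I => (h I).Bo hφ σ i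
  have Tp : ∀ K, Tst (fun x => ∑ i, ∑ j, (ca j K * Bo φ 1 i (η (insert j K)) x)
        * (ca i K * Bo φ 1 j (η (insert i K)) x)) := fun K =>
    Tst.sum _ fun i => Tst.sum _ fun j =>
      ((TB _ _ _).const_mul _).mul' ((TB _ _ _).const_mul _)
  have Tq : ∀ K, Tst (fun x => ∑ i, ∑ j, pd i (pd j φ) x
        * ((ca i K * η (insert i K) x) * (ca j K * η (insert j K) x))) := fun K =>
    Tst.sum _ fun i => Tst.sum _ fun j =>
      Tst.mul (smooth_pd (smooth_pd hφ j) i) (((h _).const_mul _).mul' ((h _).const_mul _))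
  simp_rw [Ds_sq hφ h]
  rw [← integral_finsetSum _ (fun M _ => (Tst.Dd hφ h M).sq.integrable),
    ← integral_finsetSum _ (fun K _ => ((Tp K).add (Tq K)).integrable),
    ← integral_add (Tst.sum _ fun M => (Tst.Dd hφ h M).sq).integrable
      (Tst.sum _ fun K => (Tp K).add (Tq K)).integrable]
  simp_rw [← integral_const_mul]
  rw [← integral_finsetSum _ (fun I _ => ((h I).sq.const_mul _).integrable),
    ← integral_const_mul]
  refine integral_mono ((Tst.sum _ fun I => ((h I).sq.const_mul _)).const_mul ε).integrable
    ((Tst.sum _ fun M => (Tst.Dd hφ h M).sq).add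
      (Tst.sum _ fun K => (Tp K).add (Tq K))).integrable ?_
  intro x
  simp only
  rw [Finset.sum_add_distrib, ← add_assoc]
  have h1 := d_sq (fun i I => Bo φ 1 i (η I) x)
  simp only [Dd]
  rw [h1]
  have h2 : (0:ℝ) ≤ ∑ i, ∑ I, Bo φ 1 i (η I) x ^ 2 := by positivity
  have h3 := ca_sq_sum (fun I => η I x)
  have h4 : ε * ∑ K, ∑ i, (ca i K * η (insert i K) x) ^ 2
      ≤ ∑ K, ∑ i, ∑ j, pd i (pd j φ) x
        * ((ca i K * η (insert i K) x) * (ca j K * η (insert j K) x)) := by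
    rw [Finset.mul_sum]
    refine Finset.sum_le_sum fun K _ => ?_
    exact hess_lower φ ε x (hHess x) (fun i => ca i K * η (insert i K) x)
  rw [h3] at h4
  linarith

end

section

open Filter Topology

variable {n : ℕ}

/-! ### L² convergence and mollification -/

/-- convergence in `L²`. -/
def L2T (F : ℕ → (Fin n → ℝ) → ℝ) (f : (Fin n → ℝ) → ℝ) : Prop :=
  (∀ k, MemLp (F k) 2) ∧ MemLp f 2 ∧ Tendsto (fun k => ∫ x, (F k x - f x) ^ 2) atTop (𝓝 0)

lemma norm_toLp_sq {f : (Fin n → ℝ) → ℝ} (hf : MemLp f 2) : ‖hf.toLp f‖ ^ 2 = ∫ x, f x ^ 2 := by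
  rw [← real_inner_self_eq_norm_sq, L2.inner_def]
  refine integral_congr_ae ?_
  filter_upwards [hf.coeFn_toLp] with x hx
  simp [hx, pow_two]

lemma L2T.sq {F : ℕ → (Fin n → ℝ) → ℝ} {f : (Fin n → ℝ) → ℝ} (h : L2T F f) :
    Tendsto (fun k => ∫ x, F k x ^ 2) atTop (𝓝 (∫ x, f x ^ 2)) := by
  obtain ⟨h1, h2, h3⟩ := h
  have e : ∀ k, ∫ x, (F k x - f x) ^ 2 = ‖(h1 k).toLp (F k) - h2.toLp f‖ ^ 2 := by
    intro k
    rw [← MemLp.toLp_sub, norm_toLp_sq]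
    rfl
  simp_rw [e] at h3
  have h4 : Tendsto (fun k => (h1 k).toLp (F k)) atTop (𝓝 (h2.toLp f)) := by
    rw [tendsto_iff_norm_sub_tendsto_zero]
    have := h3.sqrt
    simpa [Real.sqrt_sq] using this
  have := (h4.norm).pow 2
  simpa only [norm_toLp_sq] using this

lemma memLp_sq_int {f : (Fin n → ℝ) → ℝ} (hf : MemLp f 2) : Integrable (fun x => f x ^ 2) :=
  (memLp_two_iff_integrable_sq hf.1).1 hf

lemma L2T.const {f : (Fin n → ℝ) → ℝ} (h : MemLp f 2) : L2T (fun _ => f) f :=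
  ⟨fun _ => h, h, by simp⟩

lemma L2T.add {F G : ℕ → (Fin n → ℝ) → ℝ} {f g : (Fin n → ℝ) → ℝ} (hF : L2T F f) (hG : L2T G g) :
    L2T (fun k x => F k x + G k x) (fun x => f x + g x) := by
  obtain ⟨a1, a2, a3⟩ := hF
  obtain ⟨b1, b2, b3⟩ := hG
  refine ⟨fun k => (a1 k).add (b1 k), a2.add b2, ?_⟩
  have lim : Tendsto (fun k => 2 * (∫ x, (F k x - f x) ^ 2) + 2 * ∫ x, (G k x - g x) ^ 2) atTop
      (𝓝 0) := by
    have := (a3.const_mul 2).add (b3.const_mul 2)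
    simpa using this
  refine squeeze_zero (fun k => integral_nonneg fun x => sq_nonneg _) (fun k => ?_) lim
  have i1 := memLp_sq_int ((a1 k).sub a2)
  have i2 := memLp_sq_int ((b1 k).sub b2)
  have i3 := memLp_sq_int (((a1 k).add (b1 k)).sub (a2.add b2))
  simp only [Pi.sub_apply, Pi.add_apply] at i1 i2 i3
  rw [← integral_const_mul, ← integral_const_mul, ← integral_add (i1.const_mul 2) (i2.const_mul 2)]
  refine integral_mono i3 ((i1.const_mul 2).add (i2.const_mul 2)) fun x => ?_
  simp only [Pi.add_apply]
  nlinarith [sq_nonneg ((F k x - f x) - (G k x - g x))]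

lemma L2T.sum {ι : Type*} (s : Finset ι) {F : ι → ℕ → (Fin n → ℝ) → ℝ} {f : ι → (Fin n → ℝ) → ℝ}
    (h : ∀ i, L2T (F i) (f i)) : L2T (fun k x => ∑ i ∈ s, F i k x) (fun x => ∑ i ∈ s, f i x) := by
  classical
  induction s using Finset.induction_on with
  | empty => simpa using L2T.const (f := fun _ => 0) (MemLp.zero (ε := ℝ))
  | insert a s ha ih =>
    simp_rw [Finset.sum_insert ha]
    exact (h a).add ih

lemma memLp_bdd_mul {m f : (Fin n → ℝ) → ℝ} (hm : Continuous m) (hf : MemLp f 2) (C : ℝ)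
    (hC : ∀ x, f x ≠ 0 → |m x| ≤ C) : MemLp (fun x => m x * f x) 2 := by
  refine MemLp.of_le_mul (c := C) hf (hm.aestronglyMeasurable.mul hf.1) ?_
  refine Eventually.of_forall fun x => ?_
  rw [norm_mul]
  by_cases h : f x = 0
  · simp [h]
  · exact mul_le_mul_of_nonneg_right (hC x h) (norm_nonneg _)

lemma L2T.mul {F : ℕ → (Fin n → ℝ) → ℝ} {f m : (Fin n → ℝ) → ℝ} (hF : L2T F f)
    (hm : Continuous m) (C : ℝ) (h1 : ∀ k x, F k x ≠ 0 → |m x| ≤ C)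
    (h2 : ∀ x, f x ≠ 0 → |m x| ≤ C) :
    L2T (fun k x => m x * F k x) (fun x => m x * f x) := by
  obtain ⟨a1, a2, a3⟩ := hF
  have m1 := fun k => memLp_bdd_mul hm (a1 k) C (h1 k)
  have m2 := memLp_bdd_mul hm a2 C h2
  refine ⟨m1, m2, ?_⟩
  have lim : Tendsto (fun k => C ^ 2 * (∫ x, (F k x - f x) ^ 2)) atTop (𝓝 0) := by
    simpa using a3.const_mul (C ^ 2)
  refine squeeze_zero (fun k => integral_nonneg fun x => sq_nonneg _) (fun k => ?_) lim
  have i1 := memLp_sq_int ((a1 k).sub a2)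
  have i3 := memLp_sq_int ((m1 k).sub m2)
  simp only [Pi.sub_apply] at i1 i3
  rw [← integral_const_mul]
  refine integral_mono i3 (i1.const_mul _) fun x => ?_
  simp only
  have e : (m x * F k x - m x * f x) ^ 2 = m x ^ 2 * (F k x - f x) ^ 2 := by ring
  rw [e]
  by_cases h : F k x - f x = 0
  · simp [h]
  · refine mul_le_mul_of_nonneg_right ?_ (sq_nonneg _)
    have : |m x| ≤ C := by
      by_cases hf : f x = 0
      · exact h1 k x (by intro h'; apply h; simp [hf, h'])
      · exact h2 x hf
    rw [← sq_abs]
    exact pow_le_pow_left₀ (abs_nonneg _) this 2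

lemma L2T.const_mul {F : ℕ → (Fin n → ℝ) → ℝ} {f : (Fin n → ℝ) → ℝ} (hF : L2T F f) (c : ℝ) :
    L2T (fun k x => c * F k x) (fun x => c * f x) :=
  hF.mul (m := fun _ => c) continuous_const |c| (fun _ _ _ => le_rfl) (fun _ _ => le_rfl)

/-- dominated convergence for bounded multipliers -/
lemma L2T.dom {m : ℕ → (Fin n → ℝ) → ℝ} {f m₀ : (Fin n → ℝ) → ℝ} (hf : MemLp f 2)
    (hm : ∀ k, Continuous (m k)) (hm0 : Continuous m₀) (C : ℝ) (hC : ∀ k x, |m k x| ≤ C)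
    (hC0 : ∀ x, |m₀ x| ≤ C)
    (lim : ∀ x, Tendsto (fun k => m k x) atTop (𝓝 (m₀ x))) :
    L2T (fun k x => m k x * f x) (fun x => m₀ x * f x) := by
  refine ⟨fun k => memLp_bdd_mul (hm k) hf C fun x _ => hC k x,
    memLp_bdd_mul hm0 hf C fun x _ => hC0 x, ?_⟩
  have := tendsto_integral_of_dominated_convergence (μ := (volume : Measure (Fin n → ℝ)))
    (F := fun k x => (m k x * f x - m₀ x * f x) ^ 2)
    (f := fun _ => 0) (fun x => (2 * C) ^ 2 * f x ^ 2) ?_ ((memLp_sq_int hf).const_mul _) ?_ ?_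
  · simpa using this
  · intro k
    exact ((((hm k).aestronglyMeasurable.mul hf.1).sub (hm0.aestronglyMeasurable.mul hf.1)).pow 2)
  · intro k
    refine Eventually.of_forall fun x => ?_
    have e : (m k x * f x - m₀ x * f x) ^ 2 = (m k x - m₀ x) ^ 2 * f x ^ 2 := by ring
    rw [e, Real.norm_of_nonneg (by positivity)]
    refine mul_le_mul_of_nonneg_right ?_ (sq_nonneg _)
    rw [← sq_abs]
    refine pow_le_pow_left₀ (abs_nonneg _) ?_ 2
    have h1 := abs_le.1 (hC k x)
    have h2 := abs_le.1 (hC0 x)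
    rw [abs_le]; constructor <;> linarith
  · refine Eventually.of_forall fun x => ?_
    have := (((lim x).mul_const (f x)).sub_const (m₀ x * f x)).pow 2
    simpa using this

/-- mollifiers -/
def mbump (n : ℕ) (k : ℕ) : ContDiffBump (0 : Fin n → ℝ) where
  rIn := 1 / (2 * ((k : ℝ) + 1))
  rOut := 1 / ((k : ℝ) + 1)
  rIn_pos := by positivity
  rIn_lt_rOut := by
    apply one_div_lt_one_div_of_lt (by positivity)
    have : (0:ℝ) < (k:ℝ) + 1 := by positivity
    linarith

def rho (n k : ℕ) : (Fin n → ℝ) → ℝ := (mbump n k).normed volume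

lemma rho_tst (k : ℕ) : Tst (rho n k) :=
  ⟨(mbump n k).contDiff_normed, (mbump n k).hasCompactSupport_normed⟩

lemma rho_nonneg (k : ℕ) (x : Fin n → ℝ) : 0 ≤ rho n k x := (mbump n k).nonneg_normed x

lemma rho_int (k : ℕ) : ∫ x, rho n k x = 1 := (mbump n k).integral_normed

lemma rho_zero {k : ℕ} {x : Fin n → ℝ} (h : rho n k x ≠ 0) : ‖x‖ < 1 / ((k:ℝ) + 1) := by
  have : x ∈ Function.support (rho n k) := h
  rw [rho, (mbump n k).support_normed_eq] at this
  simpa [mbump] using this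

def mol (k : ℕ) (f : (Fin n → ℝ) → ℝ) : (Fin n → ℝ) → ℝ :=
  convolution f (rho n k) (ContinuousLinearMap.mul ℝ ℝ) volume

lemma mol_apply (k : ℕ) (f : (Fin n → ℝ) → ℝ) (x : Fin n → ℝ) :
    mol k f x = ∫ y, f y * rho n k (x - y) := rfl

lemma memLp_loc {f : (Fin n → ℝ) → ℝ} (hf : MemLp f 2) : LocallyIntegrable f :=
  hf.locallyIntegrable (by norm_num)

lemma mol_tst (k : ℕ) {f : (Fin n → ℝ) → ℝ} (hf : MemLp f 2) (hc : HasCompactSupport f) :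
    Tst (mol k f) :=
  ⟨(rho_tst k).2.contDiff_convolution_right _ (memLp_loc hf) (rho_tst k).1,
    hc.convolution _ (rho_tst k).2⟩

lemma mol_pd (k : ℕ) {f : (Fin n → ℝ) → ℝ} (hf : MemLp f 2) (i : Fin n) (x : Fin n → ℝ) :
    pd i (mol k f) x = ∫ y, f y * pd i (rho n k) (x - y) := by
  have hs : ContDiff ℝ 1 (rho n k) := (rho_tst k).1.of_le (by exact_mod_cast le_top)
  have := (rho_tst (n := n) k).2.hasFDerivAt_convolution_right (ContinuousLinearMap.mul ℝ ℝ)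
    (memLp_loc hf) hs x
  unfold pd mol
  rw [this.fderiv, convolution_precompR_apply _ (memLp_loc hf) ((rho_tst k).2.fderiv ℝ)
    (hs.continuous_fderiv one_ne_zero)]
  rfl

lemma mol_const_mul (k : ℕ) (f : (Fin n → ℝ) → ℝ) (c : ℝ) (x : Fin n → ℝ) :
    mol k (fun y => c * f y) x = c * mol k f x := by
  simp_rw [mol_apply, ← integral_const_mul, mul_assoc]

lemma mol_supp (k : ℕ) (f : (Fin n → ℝ) → ℝ) (x : Fin n → ℝ) (h : mol k f x ≠ 0) :
    x ∈ Metric.cthickening 1 (tsupport f) := by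
  by_contra hx
  apply h
  rw [mol_apply]
  have : ∀ y, f y * rho n k (x - y) = 0 := by
    intro y
    by_contra h'
    have hfy : y ∈ tsupport f := subset_tsupport f (left_ne_zero_of_mul h')
    have h2 := rho_zero (right_ne_zero_of_mul h')
    apply hx
    refine Metric.mem_cthickening_of_dist_le x y 1 _ hfy ?_
    rw [dist_eq_norm]
    refine h2.le.trans ?_
    rw [div_le_one (by positivity)]
    have : (0:ℝ) ≤ k := by positivity
    linarith
  simp [this]

lemma trans_cont {f : (Fin n → ℝ) → ℝ} (hf : MemLp f 2) :
    Tendsto (fun y : Fin n → ℝ => ∫⁻ x, ENNReal.ofReal ((f (x - y) - f x) ^ 2)) (𝓝 0) (𝓝 0) := by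
  have : Fact ((1 : ENNReal) ≤ 2) := ⟨by norm_num⟩
  let g : C(Fin n → ℝ, C(Fin n → ℝ, Fin n → ℝ)) :=
    (ContinuousMap.mk (fun a : (Fin n → ℝ) × (Fin n → ℝ) => a.2 - a.1)
      (continuous_snd.sub continuous_fst)).curry
  have hgm : ∀ y, MeasurePreserving (g y) (volume : Measure (Fin n → ℝ)) volume := fun y =>
    measurePreserving_sub_right volume y
  have hc : Continuous (fun y => Lp.compMeasurePreserving (g y) (hgm y) (hf.toLp f)) :=
    continuous_const.compMeasurePreservingLp g.continuous hgm (by norm_num)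
  have h0 : Lp.compMeasurePreserving (g 0) (hgm 0) (hf.toLp f) = hf.toLp f := by
    rw [Lp.toLp_compMeasurePreserving]
    congr 1
    ext x
    simp [g]
  have h1 := (hc.tendsto 0)
  rw [h0, tendsto_iff_norm_sub_tendsto_zero] at h1
  have h2 := ENNReal.tendsto_ofReal (h1.pow 2)
  simp only [ne_eq, OfNat.ofNat_ne_zero, not_false_eq_true, zero_pow, ENNReal.ofReal_zero] at h2
  refine h2.congr fun y => ?_
  rw [Lp.toLp_compMeasurePreserving, ← MemLp.toLp_sub, norm_toLp_sq,
    ofReal_integral_eq_lintegral_ofReal]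
  · rfl
  · exact memLp_sq_int ((hf.comp_measurePreserving (hgm y)).sub hf)
  · exact Eventually.of_forall fun x => sq_nonneg _

lemma rho_bdd (k : ℕ) : ∃ C, ∀ x, |rho n k x| ≤ C := by
  obtain ⟨C, hC⟩ := (rho_tst (n := n) k).2.exists_bound_of_continuous (rho_tst k).1.continuous
  exact ⟨C, hC⟩

lemma memLp_trans {f : (Fin n → ℝ) → ℝ} (hf : MemLp f 2) (x : Fin n → ℝ) :
    MemLp (fun y => f (x - y)) 2 :=
  hf.comp_measurePreserving (Measure.measurePreserving_sub_left volume x)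

lemma mol_swap (k : ℕ) (f : (Fin n → ℝ) → ℝ) (x : Fin n → ℝ) :
    mol k f x = ∫ y, rho n k y * f (x - y) := by
  rw [mol_apply, ← integral_sub_left_eq_self _ volume x]
  simp [mul_comm]

lemma jensen (k : ℕ) {f : (Fin n → ℝ) → ℝ} (hf : MemLp f 2) (x : Fin n → ℝ) :
    Integrable (fun y => rho n k y * (f (x - y) - f x) ^ 2) ∧
    (mol k f x - f x) ^ 2 ≤ ∫ y, rho n k y * (f (x - y) - f x) ^ 2 := by
  obtain ⟨C, hC⟩ := rho_bdd (n := n) k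
  have hr : Continuous (rho n k) := (rho_tst k).1.continuous
  have i0 : Integrable (rho n k) := (rho_tst k).integrable
  have i1 : Integrable (fun y => rho n k y * f (x - y)) := by
    have := MemLp.integrable_mul (rho_tst k).memLp (memLp_trans hf x)
    exact this
  have i2 : Integrable (fun y => rho n k y * f (x - y) ^ 2) :=
    (memLp_sq_int (memLp_trans hf x)).bdd_mul (c := C) hr.aestronglyMeasurable
      (Eventually.of_forall hC)
  set m := f x
  have i3 : Integrable (fun y => rho n k y * (f (x - y) - m) ^ 2) := by
    have := ((i2.add (i1.const_mul (-2 * m))).add (i0.const_mul (m ^ 2)))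
    refine this.congr (Eventually.of_forall fun y => ?_)
    simp only [Pi.add_apply]; ring
  refine ⟨i3, ?_⟩
  rw [mol_swap]
  set a := ∫ y, rho n k y * f (x - y) with ha
  have E : ∀ c : ℝ, ∫ y, rho n k y * (f (x - y) - c) ^ 2
      = (∫ y, rho n k y * f (x - y) ^ 2) + (-2 * c) * a + c ^ 2 := by
    intro c
    have : ∀ y, rho n k y * (f (x - y) - c) ^ 2 = rho n k y * f (x - y) ^ 2 +
      (-2 * c) * (rho n k y * f (x - y)) + c ^ 2 * rho n k y := by intro y; ring
    simp_rw [this]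
    have i4 : Integrable (fun y => rho n k y * f (x - y) ^ 2 +
      (-2 * c) * (rho n k y * f (x - y))) := i2.add (i1.const_mul (-2 * c))
    rw [integral_add i4 (i0.const_mul (c ^ 2)),
      integral_add i2 (i1.const_mul (-2 * c)), integral_const_mul, integral_const_mul, rho_int]
    ring
  have e1 := E m
  have e2 := E a
  have e3 : 0 ≤ ∫ y, rho n k y * (f (x - y) - a) ^ 2 :=
    integral_nonneg fun y => mul_nonneg (rho_nonneg k y) (sq_nonneg _)
  rw [e1]
  nlinarith

lemma mol_L2T {f : (Fin n → ℝ) → ℝ} (hf : MemLp f 2) (hc : HasCompactSupport f) :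
    L2T (fun k => mol k f) f := by
  refine ⟨fun k => (mol_tst k hf hc).memLp, hf, ?_⟩
  have key : ∀ k, ENNReal.ofReal (∫ x, (mol k f x - f x) ^ 2)
      ≤ ∫⁻ y, ENNReal.ofReal (rho n k y) * ∫⁻ x, ENNReal.ofReal ((f (x - y) - f x) ^ 2) := by
    intro k
    have i := memLp_sq_int ((mol_tst k hf hc).memLp.sub hf)
    simp only [Pi.sub_apply] at i
    rw [ofReal_integral_eq_lintegral_ofReal i (Eventually.of_forall fun x => sq_nonneg _)]
    calc _ ≤ ∫⁻ x, ∫⁻ y, ENNReal.ofReal (rho n k y * (f (x - y) - f x) ^ 2) := by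
          refine lintegral_mono fun x => ?_
          obtain ⟨j1, j2⟩ := jensen k hf x
          rw [← ofReal_integral_eq_lintegral_ofReal j1
            (Eventually.of_forall fun y => mul_nonneg (rho_nonneg k y) (sq_nonneg _))]
          exact ENNReal.ofReal_le_ofReal j2
      _ = ∫⁻ y, ∫⁻ x, ENNReal.ofReal (rho n k y * (f (x - y) - f x) ^ 2) := by
          refine lintegral_lintegral_swap ?_
          refine AEMeasurable.ennreal_ofReal ?_
          have m1 : AEMeasurable (fun p : (Fin n → ℝ) × (Fin n → ℝ) => f (p.1 - p.2))
              (volume.prod volume) :=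
            hf.1.aemeasurable.comp_quasiMeasurePreserving
              (quasiMeasurePreserving_sub_of_right_invariant volume volume)
          have m2 : AEMeasurable (fun p : (Fin n → ℝ) × (Fin n → ℝ) => f p.1)
              (volume.prod volume) := hf.1.aemeasurable.comp_fst
          have m3 : AEMeasurable (fun p : (Fin n → ℝ) × (Fin n → ℝ) => rho n k p.2)
              (volume.prod volume) :=
            (((rho_tst k).1.continuous.comp continuous_snd).measurable).aemeasurable
          exact m3.mul ((m1.sub m2).pow_const 2)
      _ = _ := by
          refine lintegral_congr fun y => ?_
          simp_rw [ENNReal.ofReal_mul (rho_nonneg k y)]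
          rw [lintegral_const_mul' _ _ ENNReal.ofReal_ne_top]
  rw [Metric.tendsto_atTop]
  intro δ hδ
  have h1 := (ENNReal.tendsto_nhds_zero.1 (trans_cont hf)) (ENNReal.ofReal (δ/2))
    (by simpa using hδ)
  obtain ⟨r, hr, h2⟩ := Metric.eventually_nhds_iff.1 h1
  obtain ⟨N, hN⟩ := exists_nat_one_div_lt hr
  refine ⟨N, fun k hk => ?_⟩
  have h3 : ENNReal.ofReal (∫ x, (mol k f x - f x) ^ 2) ≤ ENNReal.ofReal (δ/2) := by
    refine (key k).trans ?_
    calc _ ≤ ∫⁻ y, ENNReal.ofReal (rho n k y) * ENNReal.ofReal (δ/2) := by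
          refine lintegral_mono fun y => ?_
          by_cases hy : rho n k y = 0
          · simp [hy]
          · refine mul_le_mul_right ?_ _
            apply h2
            rw [dist_zero_right]
            refine (rho_zero hy).trans (lt_of_le_of_lt ?_ hN)
            apply one_div_le_one_div_of_le (by positivity)
            have : (N:ℝ) ≤ k := by exact_mod_cast hk
            linarith
      _ = _ := by
          rw [lintegral_mul_const' _ _ ENNReal.ofReal_ne_top,
            ← ofReal_integral_eq_lintegral_ofReal (rho_tst k).integrable
              (Eventually.of_forall fun y => rho_nonneg k y), rho_int]
          simp
  have h4 : ∫ x, (mol k f x - f x) ^ 2 ≤ δ / 2 :=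
    (ENNReal.ofReal_le_ofReal_iff (by positivity)).1 h3
  rw [Real.dist_0_eq_abs, abs_of_nonneg (integral_nonneg fun x => sq_nonneg _)]
  linarith

end

section

open Filter Topology

variable {n : ℕ}

/-! ### The Bochner inequality for weak solutions -/

lemma int_mul {f ψ : (Fin n → ℝ) → ℝ} (hf : MemLp f 2) (hψ : Tst ψ) :
    Integrable (fun x => f x * ψ x) :=
  MemLp.integrable_mul hf hψ.memLp

lemma Tst.bdd {f : (Fin n → ℝ) → ℝ} (hf : Tst f) : ∃ C, ∀ x, |f x| ≤ C :=
  hf.2.exists_bound_of_continuous hf.1.continuous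

lemma tst_mul_memLp {χ f : (Fin n → ℝ) → ℝ} (hχ : Tst χ) (hf : MemLp f 2) :
    MemLp (fun x => χ x * f x) 2 := by
  obtain ⟨C, hC⟩ := hχ.bdd
  exact memLp_bdd_mul hχ.1.continuous hf C fun x _ => hC x

lemma tst_shift (k : ℕ) (x : Fin n → ℝ) : Tst (fun y => rho n k (x - y)) := by
  refine ⟨(rho_tst k).1.comp (contDiff_const.sub contDiff_id), ?_⟩
  exact (rho_tst k).2.comp_homeomorph (Homeomorph.subLeft x)

lemma pd_shift (k : ℕ) (i : Fin n) (x y : Fin n → ℝ) :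
    pd i (fun y => rho n k (x - y)) y = - pd i (rho n k) (x - y) := by
  unfold pd
  have h1 : HasFDerivAt (fun y : Fin n → ℝ => x - y) (-ContinuousLinearMap.id ℝ (Fin n → ℝ)) y :=
    (hasFDerivAt_id y).const_sub x
  have h2 : HasFDerivAt (rho n k) (fderiv ℝ (rho n k) (x - y)) (x - y) :=
    (smooth_diff (rho_tst k).1 (x - y)).hasFDerivAt
  have h3 := h2.comp y h1
  have h4 : fderiv ℝ (fun y => rho n k (x - y)) y = _ := h3.fderiv
  rw [h4]
  simp

lemma weak_mol {φ : (Fin n → ℝ) → ℝ} (hφ : ContDiff ℝ (⊤ : ℕ∞) φ) (σ : ℝ)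
    (u : Fin n → (Fin n → ℝ) → ℝ) (hu : ∀ i, MemLp (u i) 2) (h : (Fin n → ℝ) → ℝ)
    (hh : MemLp h 2)
    (weak : ∀ ψ, Tst ψ → ∑ i, ∫ x, u i x * Bo φ (-σ) i ψ x = ∫ x, h x * ψ x)
    (χ : (Fin n → ℝ) → ℝ) (hχ : Tst χ) :
    L2T (fun k x => ∑ i, Bo φ σ i (mol k (fun y => χ y * u i y)) x)
      (fun x => χ x * h x + σ * ∑ i, pd i χ x * u i x) := by
  have hv : ∀ i, MemLp (fun y => χ y * u i y) 2 := fun i => tst_mul_memLp hχ (hu i)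
  have hvc : ∀ i, HasCompactSupport (fun y => χ y * u i y) := fun i => hχ.2.mul_right
  have hp : ∀ i, MemLp (fun y => pd i φ y / 2 * χ y * u i y) 2 := fun i =>
    tst_mul_memLp (Tst.mul ((smooth_pd hφ i).div_const 2) hχ) (hu i)
  have hpc : ∀ i, HasCompactSupport (fun y => pd i φ y / 2 * χ y * u i y) := fun i =>
    (Tst.mul ((smooth_pd hφ i).div_const 2) hχ).2.mul_right
  have ht : ∀ i, MemLp (fun y => pd i χ y * u i y) 2 := fun i =>
    tst_mul_memLp (hχ.pd i) (hu i)
  have htc : ∀ i, HasCompactSupport (fun y => pd i χ y * u i y) := fun i =>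
    (hχ.pd i).2.mul_right
  set q : (Fin n → ℝ) → ℝ := fun x => χ x * h x + ∑ i, (σ * (pd i χ x * u i x)
    + (-1) * (pd i φ x / 2 * χ x * u i x)) with hq
  have qm : MemLp q 2 := (tst_mul_memLp hχ hh).add
    (memLp_finsetSum _ fun i _ => ((ht i).const_mul σ).add ((hp i).const_mul (-1)))
  have qc : HasCompactSupport q := by
    refine HasCompactSupport.intro hχ.2 ?_
    intro x hx
    have h0 : χ x = 0 := image_eq_zero_of_notMem_tsupport hx
    have h1 : ∀ i, pd i χ x = 0 := fun i => by
      by_contra h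
      have : x ∈ tsupport (fderiv ℝ χ) := subset_tsupport _ (by
        intro h'; apply h; simp [pd, h'])
      exact hx (tsupport_fderiv_subset ℝ this)
    simp [hq, h0, h1]
  have e : ∀ k x, σ * ∑ i, pd i (mol k (fun y => χ y * u i y)) x = mol k q x := by
    intro k x
    simp_rw [mol_pd k (hv _)]
    set ψ : (Fin n → ℝ) → ℝ := fun y => rho n k (x - y) with hψd
    have hψ : Tst ψ := tst_shift k x
    have e1 : ∀ i y, pd i (rho n k) (x - y) = - pd i ψ y := by
      intro i y; rw [hψd, pd_shift]; ring
    simp_rw [e1]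
    have w := weak _ (hχ.mul' hψ)
    have j2 : ∀ i, Integrable (fun y => (σ * (pd i χ y * u i y)
          + (-1) * (pd i φ y / 2 * χ y * u i y)) * ψ y) := fun i =>
      int_mul (((ht i).const_mul σ).add ((hp i).const_mul (-1))) hψ
    have e2 : ∀ i, ∫ y, u i y * Bo φ (-σ) i (fun x => χ x * ψ x) y
       = σ * (∫ y, χ y * u i y * - pd i ψ y) + (-∫ y, (σ * (pd i χ y * u i y)
          + (-1) * (pd i φ y / 2 * χ y * u i y)) * ψ y) := by
      intro i
      have j1 : Integrable (fun y => χ y * u i y * - pd i ψ y) := by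
        have := (int_mul (hv i) (hψ.pd i)).neg
        refine this.congr (Eventually.of_forall fun y => ?_)
        simp
      have j3 : Integrable (fun y => -((σ * (pd i χ y * u i y)
          + (-1) * (pd i φ y / 2 * χ y * u i y)) * ψ y)) := (j2 i).neg
      rw [← integral_const_mul, ← integral_neg, ← integral_add (j1.const_mul σ) j3]
      congr 1
      ext y
      rw [Bo, pd_mul hχ.1 hψ.1]
      ring
    simp_rw [e2] at w
    rw [Finset.sum_add_distrib, ← Finset.mul_sum] at w
    have e3 : mol k q x = (∫ y, h y * (χ y * ψ y)) + ∑ i, ∫ y, (σ * (pd i χ y * u i y)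
          + (-1) * (pd i φ y / 2 * χ y * u i y)) * ψ y := by
      rw [← integral_finsetSum _ fun i _ => j2 i]
      rw [← integral_add (int_mul hh (hχ.mul' hψ))
        (integrable_finsetSum _ fun i _ => j2 i)]
      rw [mol_apply]
      congr 1
      ext y
      simp only [hq]
      rw [add_mul, Finset.sum_mul]
      ring
    rw [e3, ← w, Finset.sum_neg_distrib]
    ring
  have L1 := mol_L2T qm qc
  have L2 : ∀ i, L2T (fun k x => pd i φ x / 2 * mol k (fun y => χ y * u i y) x)
      (fun x => pd i φ x / 2 * (χ x * u i x)) := by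
    intro i
    have hK : IsCompact (Metric.cthickening 1 (tsupport (fun y => χ y * u i y))) :=
      (hvc i).isCompact.cthickening
    have hcont : Continuous (fun x => pd i φ x / 2) := ((smooth_pd hφ i).div_const 2).continuous
    obtain ⟨C, hC⟩ := hK.exists_bound_of_continuousOn hcont.continuousOn
    refine (mol_L2T (hv i) (hvc i)).mul hcont C (fun k x hx => hC x (mol_supp k _ x hx)) ?_
    intro x hx
    exact hC x (Metric.self_subset_cthickening _ (subset_tsupport _ hx))
  have L3 := L1.add (L2T.sum Finset.univ L2)
  have E1 : (fun k x => ∑ i, Bo φ σ i (mol k (fun y => χ y * u i y)) x)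
     = fun k x => mol k q x + ∑ i, pd i φ x / 2 * mol k (fun y => χ y * u i y) x := by
    ext k x
    rw [← e, Finset.mul_sum, ← Finset.sum_add_distrib]
    rfl
  have E2 : (fun x => χ x * h x + σ * ∑ i, pd i χ x * u i x)
     = fun x => q x + ∑ i, pd i φ x / 2 * (χ x * u i x) := by
    ext x
    rw [hq]
    simp only
    rw [add_assoc, ← Finset.sum_add_distrib, Finset.mul_sum]
    congr 1
    refine Finset.sum_congr rfl fun i _ => ?_
    ring
  rw [E1, E2]
  exact L3

lemma weak_cut {φ : (Fin n → ℝ) → ℝ} (hφ : ContDiff ℝ (⊤ : ℕ∞) φ) (ε : ℝ)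
    (hHess : ∀ x, ((hessM n φ x) - ε • (1 : Matrix (Fin n) (Fin n) ℝ)).PosSemidef)
    (w g : Coef n) (hw : ∀ I, MemLp (w I) 2) (hg : ∀ I, MemLp (g I) 2)
    (hd : ∀ M ψ, Tst ψ → ∑ i, ∫ x, (ce i M * w (M.erase i) x) * Bo φ (-1) i ψ x = 0)
    (hs : ∀ K ψ, Tst ψ → ∑ i, ∫ x, (ca i K * w (insert i K) x) * Bo φ 1 i ψ x
      = ∫ x, g K x * ψ x) (χ : (Fin n → ℝ) → ℝ) (hχ : Tst χ) :
    ε * ∑ I : Finset (Fin n), (I.card : ℝ) * ∫ x, (χ x * w I x) ^ 2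
      ≤ (∑ M, ∫ x, (∑ i, pd i χ x * (ce i M * w (M.erase i) x)) ^ 2)
        + ∑ K, ∫ x, (χ x * g K x + (-1) * ∑ i, pd i χ x * (ca i K * w (insert i K) x)) ^ 2 := by
  have hη : ∀ k I, Tst (mol k (fun y => χ y * w I y)) := fun k I =>
    mol_tst k (tst_mul_memLp hχ (hw I)) hχ.2.mul_right
  have key := fun k => bochner hφ ε hHess (η := fun I => mol k (fun y => χ y * w I y)) (hη k)
  have l1 : ∀ I, Tendsto (fun k => ∫ x, (mol k (fun y => χ y * w I y) x) ^ 2) atTop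
      (𝓝 (∫ x, (χ x * w I x) ^ 2)) := fun I =>
    (mol_L2T (tst_mul_memLp hχ (hw I)) hχ.2.mul_right).sq
  have l2 : ∀ M, Tendsto (fun k => ∫ x, (Dd φ (fun I => mol k (fun y => χ y * w I y)) M x) ^ 2)
      atTop (𝓝 (∫ x, (∑ i, pd i χ x * (ce i M * w (M.erase i) x)) ^ 2)) := by
    intro M
    have := (weak_mol hφ 1 (fun i x => ce i M * w (M.erase i) x) (fun i => (hw _).const_mul _)
      (fun _ => 0) MemLp.zero (by intro ψ hψ; rw [hd M ψ hψ]; simp) χ hχ).sq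
    simp only [mul_zero, zero_add, one_mul] at this
    refine this.congr fun k => ?_
    congr 1
    ext x
    congr 1
    unfold Dd
    refine Finset.sum_congr rfl fun i _ => ?_
    rw [← Bo_const_mul (hη k _).1]
    congr 1
    ext z
    rw [← mol_const_mul]
    congr 1
    ext y; ring
  have l3 : ∀ K, Tendsto (fun k => ∫ x, (Ds φ (fun I => mol k (fun y => χ y * w I y)) K x) ^ 2)
      atTop (𝓝 (∫ x, (χ x * g K x + (-1) * ∑ i, pd i χ x * (ca i K * w (insert i K) x)) ^ 2)) := by
    intro K
    have := (weak_mol hφ (-1) (fun i x => ca i K * w (insert i K) x) (fun i => (hw _).const_mul _)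
      (g K) (hg K) (by intro ψ hψ; rw [neg_neg]; exact hs K ψ hψ) χ hχ).sq
    refine this.congr fun k => ?_
    congr 1
    ext x
    congr 1
    unfold Ds
    refine Finset.sum_congr rfl fun i _ => ?_
    rw [← Bo_const_mul (hη k _).1]
    congr 1
    ext z
    rw [← mol_const_mul]
    congr 1
    ext y; ring
  have A1 := (tendsto_finsetSum (Finset.univ : Finset (Finset (Fin n)))
    fun I _ => (l1 I).const_mul (I.card : ℝ)).const_mul ε
  have A2 := (tendsto_finsetSum (Finset.univ : Finset (Finset (Fin n))) fun M _ => l2 M).add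
    (tendsto_finsetSum (Finset.univ : Finset (Finset (Fin n))) fun K _ => l3 K)
  exact le_of_tendsto_of_tendsto' A1 A2 key

/-- cut-off functions -/
def chi0 (n : ℕ) : ContDiffBump (0 : Fin n → ℝ) where
  rIn := 1
  rOut := 2
  rIn_pos := by norm_num
  rIn_lt_rOut := by norm_num

def chi (n k : ℕ) (x : Fin n → ℝ) : ℝ := chi0 n ((1 / ((k : ℝ) + 1)) • x)

lemma chi0_tst : Tst (chi0 n : (Fin n → ℝ) → ℝ) :=
  ⟨(chi0 n).contDiff, (chi0 n).hasCompactSupport⟩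

lemma chi_tst (k : ℕ) : Tst (chi n k) := by
  have hk : (1 / ((k : ℝ) + 1)) ≠ 0 := by positivity
  refine ⟨chi0_tst.1.comp (contDiff_const_smul _), ?_⟩
  exact chi0_tst.2.comp_homeomorph (Homeomorph.smulOfNeZero _ hk)

lemma chi_abs (k : ℕ) (x : Fin n → ℝ) : |chi n k x| ≤ 1 := by
  rw [abs_le]
  refine ⟨by linarith [(chi0 n).nonneg' ((1 / ((k : ℝ) + 1)) • x), show chi n k x = chi0 n ((1 / ((k : ℝ) + 1)) • x) from rfl], (chi0 n).le_one⟩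

lemma chi_pd (k : ℕ) (i : Fin n) (x : Fin n → ℝ) :
    pd i (chi n k) x = (1 / ((k : ℝ) + 1)) * pd i (chi0 n) ((1 / ((k : ℝ) + 1)) • x) := by
  unfold pd
  have : chi n k = fun x => chi0 n ((1 / ((k : ℝ) + 1)) • x) := rfl
  rw [this, fderiv_comp_smul]
  simp

lemma chi_lim (x : Fin n → ℝ) : Tendsto (fun k => chi n k x) atTop (𝓝 1) := by
  have h1 : Tendsto (fun k : ℕ => (1 / ((k : ℝ) + 1)) • x) atTop (𝓝 ((0:ℝ) • x)) :=
    tendsto_one_div_add_atTop_nhds_zero_nat.smul_const x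
  rw [zero_smul] at h1
  have h2 := (chi0_tst.1.continuous.tendsto (0 : Fin n → ℝ)).comp h1
  have h3 : chi0 n 0 = 1 := (chi0 n).one_of_mem_closedBall (by simp [chi0])
  rw [h3] at h2
  exact h2

lemma weak_bochner {φ : (Fin n → ℝ) → ℝ} (hφ : ContDiff ℝ (⊤ : ℕ∞) φ) (ε : ℝ)
    (hHess : ∀ x, ((hessM n φ x) - ε • (1 : Matrix (Fin n) (Fin n) ℝ)).PosSemidef)
    (w g : Coef n) (hw : ∀ I, MemLp (w I) 2) (hg : ∀ I, MemLp (g I) 2)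
    (hd : ∀ M ψ, Tst ψ → ∑ i, ∫ x, (ce i M * w (M.erase i) x) * Bo φ (-1) i ψ x = 0)
    (hs : ∀ K ψ, Tst ψ → ∑ i, ∫ x, (ca i K * w (insert i K) x) * Bo φ 1 i ψ x
      = ∫ x, g K x * ψ x) :
    ε * ∑ I : Finset (Fin n), (I.card : ℝ) * ∫ x, (w I x) ^ 2 ≤ ∑ K, ∫ x, (g K x) ^ 2 := by
  have key := fun k => weak_cut hφ ε hHess w g hw hg hd hs (chi n k) (chi_tst k)
  have m1 : ∀ f : (Fin n → ℝ) → ℝ, MemLp f 2 → L2T (fun k x => chi n k x * f x) f := by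
    intro f hf
    have := L2T.dom (m := chi n) (m₀ := fun _ => 1) hf (fun k => (chi_tst k).1.continuous)
      continuous_const 1 chi_abs (by simp) chi_lim
    simpa using this
  have m2 : ∀ (i : Fin n) (f : (Fin n → ℝ) → ℝ), MemLp f 2 →
      L2T (fun k x => pd i (chi n k) x * f x) (fun _ => 0) := by
    intro i f hf
    obtain ⟨C, hC⟩ := (chi0_tst.pd i : Tst (pd i (chi0 n))).bdd
    have hC0 : 0 ≤ C := (abs_nonneg _).trans (hC 0)
    have hb : ∀ k x, |pd i (chi n k) x| ≤ (1 / ((k : ℝ) + 1)) * C := by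
      intro k x
      rw [chi_pd, abs_mul, abs_of_nonneg (by positivity : (0:ℝ) ≤ 1 / ((k : ℝ) + 1))]
      exact mul_le_mul_of_nonneg_left (hC _) (by positivity)
    have hb1 : ∀ k : ℕ, (1 / ((k : ℝ) + 1)) * C ≤ C := by
      intro k
      refine mul_le_of_le_one_left hC0 ?_
      rw [div_le_one (by positivity)]
      have : (0:ℝ) ≤ k := by positivity
      linarith
    have := L2T.dom (m := fun k => pd i (chi n k)) (m₀ := fun _ => 0) hf
      (fun k => ((chi_tst k).pd i).1.continuous)
      continuous_const C (fun k x => (hb k x).trans (hb1 k)) (by simpa using hC0) (by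
        intro x
        refine squeeze_zero_norm (fun k => hb k x) ?_
        simpa using tendsto_one_div_add_atTop_nhds_zero_nat.mul_const C)
    simpa using this
  have l1 := fun I => (m1 (w I) (hw I)).sq
  have l2 : ∀ M, Tendsto (fun k => ∫ x, (∑ i, pd i (chi n k) x * (ce i M * w (M.erase i) x)) ^ 2)
      atTop (𝓝 0) := by
    intro M
    have := (L2T.sum Finset.univ fun i => m2 i (fun x => ce i M * w (M.erase i) x)
      ((hw _).const_mul _)).sq
    simpa using this
  have l3 : ∀ K, Tendsto (fun k => ∫ x, (chi n k x * g K x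
      + (-1) * ∑ i, pd i (chi n k) x * (ca i K * w (insert i K) x)) ^ 2)
      atTop (𝓝 (∫ x, g K x ^ 2)) := by
    intro K
    have := ((m1 (g K) (hg K)).add
      ((L2T.sum Finset.univ fun i => m2 i (fun x => ca i K * w (insert i K) x)
      ((hw _).const_mul _)).const_mul (-1))).sq
    simpa using this
  have A1 := (tendsto_finsetSum (Finset.univ : Finset (Finset (Fin n)))
    fun I _ => (l1 I).const_mul (I.card : ℝ)).const_mul ε
  have A2 := (tendsto_finsetSum (Finset.univ : Finset (Finset (Fin n))) fun M _ => l2 M).add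
    (tendsto_finsetSum (Finset.univ : Finset (Finset (Fin n))) fun K _ => l3 K)
  simp only [Finset.sum_const_zero, zero_add] at A2
  exact le_of_tendsto_of_tendsto' A1 A2 key

end

section

variable {n : ℕ}

/-! ### Pairings -/

lemma hilb {V H : Type*} [AddCommGroup V] [Module ℝ V] [NormedAddCommGroup H]
    [InnerProductSpace ℝ H] [CompleteSpace H] (T : V →ₗ[ℝ] H) (L : V →ₗ[ℝ] ℝ) (C : ℝ)
    (hC : 0 ≤ C) (h : ∀ v, |L v| ≤ C * ‖T v‖) :
    ∃ a : H, ‖a‖ ≤ C ∧ ∀ v, inner ℝ a (T v) = L v := by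
  obtain ⟨s, hs⟩ := T.rangeRestrict.exists_rightInverse_of_surjective T.range_rangeRestrict
  have hs' : ∀ y : LinearMap.range T, T (s y) = y := by
    intro y
    have := congrArg (fun f => ((f y : LinearMap.range T) : H)) hs
    simpa using this
  let f0 : LinearMap.range T →ₗ[ℝ] ℝ := L ∘ₗ s
  have hf0 : ∀ y, ‖f0 y‖ ≤ C * ‖y‖ := by
    intro y
    have := h (s y)
    rw [hs' y] at this
    simpa [f0] using this
  let f := f0.mkContinuous C hf0
  obtain ⟨g, hg, hgn⟩ := exists_extension_norm_eq (𝕜 := ℝ) (LinearMap.range T) f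
  refine ⟨(InnerProductSpace.toDual ℝ H).symm g, ?_, ?_⟩
  · rw [LinearIsometryEquiv.norm_map, hgn]
    exact f0.mkContinuous_norm_le hC hf0
  · intro v
    rw [InnerProductSpace.toDual_symm_apply]
    have h1 := hg ⟨T v, LinearMap.mem_range_self T v⟩
    simp only at h1
    rw [h1]
    change L (s ⟨T v, _⟩) = L v
    have h2 := h (s ⟨T v, LinearMap.mem_range_self T v⟩ - v)
    rw [map_sub, map_sub, hs'] at h2
    simp only [sub_self, norm_zero, mul_zero] at h2
    have := abs_eq_zero.1 (le_antisymm h2 (abs_nonneg _))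
    linarith

lemma proj_ex {H : Type*} [NormedAddCommGroup H]
    [InnerProductSpace ℝ H] [CompleteSpace H] (R : Submodule ℝ H) (x : H) :
    ∃ w ∈ Rᗮ, ∀ v ∈ Rᗮ, inner ℝ x v = inner ℝ w v := by
  refine ⟨Rᗮ.starProjection x, Rᗮ.starProjection_apply_mem _, fun v hv => ?_⟩
  have := Rᗮ.starProjection_inner_eq_zero x _ hv
  rw [inner_sub_left] at this
  linarith

def pair (f g : Coef n) : ℝ := ∑ I, ∫ x, f I x * g I x

lemma pair_Ds {φ : (Fin n → ℝ) → ℝ} (hφ : ContDiff ℝ (⊤ : ℕ∞) φ) {v θ : Coef n}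
    (hv : ∀ I, MemLp (v I) 2) (hθ : ∀ I, Tst (θ I)) :
    pair v (Ds φ θ) = ∑ M, ∑ i, ∫ x, (ce i M * v (M.erase i) x) * Bo φ (-1) i (θ M) x := by
  have j : ∀ c : ℝ, ∀ K M i, Integrable (fun x => (c * v K x) * Bo φ (-1) i (θ M) x) := by
    intro c K M i
    exact int_mul ((hv K).const_mul c) ((hθ M).Bo hφ _ _)
  have e1 : ∀ K, ∫ x, v K x * Ds φ θ K x
      = ∑ i, ∫ x, (ca i K * v K x) * Bo φ (-1) i (θ (insert i K)) x := by
    intro K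
    rw [← integral_finsetSum _ fun i _ => j _ _ _ _]
    congr 1; ext x
    rw [Ds, Finset.mul_sum]
    refine Finset.sum_congr rfl fun i _ => ?_
    ring
  unfold pair
  simp_rw [e1]
  rw [Finset.sum_comm]
  conv_rhs => rw [Finset.sum_comm]
  refine Finset.sum_congr rfl fun i _ => ?_
  rw [← integral_finsetSum _ fun K _ => j _ _ _ _, ← integral_finsetSum _ fun K _ => j _ _ _ _]
  congr 1; ext x
  have := ce_adj i (fun K => v K x) (fun M => Bo φ (-1) i (θ M) x)
  rw [this]
  refine Finset.sum_congr rfl fun i _ => ?_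
  ring

lemma pair_Dd {φ : (Fin n → ℝ) → ℝ} (hφ : ContDiff ℝ (⊤ : ℕ∞) φ) {v θ : Coef n}
    (hv : ∀ I, MemLp (v I) 2) (hθ : ∀ I, Tst (θ I)) :
    pair v (Dd φ θ) = ∑ K, ∑ i, ∫ x, (ca i K * v (insert i K) x) * Bo φ 1 i (θ K) x := by
  have j : ∀ c : ℝ, ∀ K M i, Integrable (fun x => (c * v K x) * Bo φ 1 i (θ M) x) := by
    intro c K M i
    exact int_mul ((hv K).const_mul c) ((hθ M).Bo hφ _ _)
  have e1 : ∀ K, ∫ x, v K x * Dd φ θ K x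
      = ∑ i, ∫ x, (ce i K * v K x) * Bo φ 1 i (θ (K.erase i)) x := by
    intro K
    rw [← integral_finsetSum _ fun i _ => j _ _ _ _]
    congr 1; ext x
    rw [Dd, Finset.mul_sum]
    refine Finset.sum_congr rfl fun i _ => ?_
    ring
  unfold pair
  simp_rw [e1]
  rw [Finset.sum_comm]
  conv_rhs => rw [Finset.sum_comm]
  refine Finset.sum_congr rfl fun i _ => ?_
  rw [← integral_finsetSum _ fun K _ => j _ _ _ _, ← integral_finsetSum _ fun K _ => j _ _ _ _]
  congr 1; ext x
  have := ce_adj i (fun M => Bo φ 1 i (θ M) x) (fun K => v K x)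
  calc _ = ∑ M, (ce i M * Bo φ 1 i (θ (M.erase i)) x) * v M x :=
        Finset.sum_congr rfl fun i _ => by ring
    _ = _ := by
      rw [this]
      exact Finset.sum_congr rfl fun i _ => by ring

lemma pair_adj {φ : (Fin n → ℝ) → ℝ} (hφ : ContDiff ℝ (⊤ : ℕ∞) φ) {η θ : Coef n}
    (hη : ∀ I, Tst (η I)) (hθ : ∀ I, Tst (θ I)) :
    pair η (Dd φ θ) = pair (Ds φ η) θ := by
  rw [pair_Dd hφ (fun I => (hη I).memLp) hθ]
  unfold pair
  refine Finset.sum_congr rfl fun K _ => ?_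
  have j : ∀ i, Integrable (fun x => ca i K * Bo φ (-1) i (η (insert i K)) x * θ K x) := fun i =>
    ((((hη _).Bo hφ _ _).const_mul _).mul' (hθ K)).integrable
  calc _ = ∑ i, ∫ x, ca i K * Bo φ (-1) i (η (insert i K)) x * θ K x := by
        refine Finset.sum_congr rfl fun i _ => ?_
        simp_rw [mul_assoc]
        rw [integral_const_mul, integral_const_mul, Bo_adj hφ (hη _) (hθ _), neg_neg]
    _ = _ := by
      rw [← integral_finsetSum _ fun i _ => j i]
      congr 1; ext x
      rw [Ds, Finset.sum_mul]

lemma Bo_sum {φ : (Fin n → ℝ) → ℝ} {ι : Type*} (s : Finset ι) {f : ι → (Fin n → ℝ) → ℝ}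
    (hf : ∀ i, Tst (f i)) (σ : ℝ) (i : Fin n) (x : Fin n → ℝ) :
    Bo φ σ i (fun y => ∑ j ∈ s, f j y) x = ∑ j ∈ s, Bo φ σ i (f j) x := by
  classical
  induction s using Finset.induction_on with
  | empty => simp [Bo, pd]
  | insert a s ha ih =>
    simp_rw [Finset.sum_insert ha]
    rw [Bo_add (hf a).1 (Tst.sum s hf).1, ih]

lemma Dd_Dd {φ : (Fin n → ℝ) → ℝ} (hφ : ContDiff ℝ (⊤ : ℕ∞) φ) {f : Coef n}
    (hf : ∀ I, Tst (f I)) (M : Finset (Fin n)) (x : Fin n → ℝ) :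
    ∑ i, ce i M * Bo φ 1 i (Dd φ f (M.erase i)) x = 0 := by
  have := ce_anti M (fun j i K => Bo φ 1 j (Bo φ 1 i (f K)) x)
    (fun i j K => Bo_comm' hφ (hf K).1 i j x)
  rw [← this]
  refine Finset.sum_congr rfl fun i _ => ?_
  rw [← Finset.mul_sum]
  congr 1
  unfold Dd
  rw [Bo_sum _ (fun j => ((hf _).Bo hφ _ _).const_mul _)]
  refine Finset.sum_congr rfl fun j _ => ?_
  rw [Bo_const_mul ((hf _).Bo hφ _ _).1]

lemma pair_Dd_Ds {φ : (Fin n → ℝ) → ℝ} (hφ : ContDiff ℝ (⊤ : ℕ∞) φ) {f θ : Coef n}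
    (hf : ∀ I, Tst (f I)) (hθ : ∀ I, Tst (θ I)) :
    pair (Dd φ f) (Ds φ θ) = 0 := by
  rw [pair_Ds hφ (fun I => (Tst.Dd hφ hf I).memLp) hθ]
  refine Finset.sum_eq_zero fun M _ => ?_
  have hD := Tst.Dd hφ hf
  have j : ∀ i, Integrable (fun x => ce i M * Bo φ 1 i (Dd φ f (M.erase i)) x * θ M x) := fun i =>
    ((((hD _).Bo hφ _ _).const_mul _).mul' (hθ M)).integrable
  calc _ = ∑ i, ∫ x, ce i M * Bo φ 1 i (Dd φ f (M.erase i)) x * θ M x := by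
        refine Finset.sum_congr rfl fun i _ => ?_
        simp_rw [mul_assoc]
        rw [integral_const_mul, integral_const_mul, Bo_adj hφ (hD _) (hθ _)]
    _ = 0 := by
      rw [← integral_finsetSum _ fun i _ => j i]
      simp_rw [← Finset.sum_mul, Dd_Dd hφ hf]
      simp

/-! ### Hilbert space of forms -/

abbrev HS (n : ℕ) := PiLp 2 (fun _ : Finset (Fin n) => Lp ℝ 2 (volume : Measure (Fin n → ℝ)))

def toH (f : Coef n) (hf : ∀ I, MemLp (f I) 2) : HS n :=
  WithLp.toLp 2 (fun I => (hf I).toLp (f I))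

lemma toH_inner (f g : Coef n) (hf : ∀ I, MemLp (f I) 2) (hg : ∀ I, MemLp (g I) 2) :
    inner ℝ (toH f hf) (toH g hg) = pair f g := by
  rw [PiLp.inner_apply]
  refine Finset.sum_congr rfl fun I _ => ?_
  rw [L2.inner_def]
  refine integral_congr_ae ?_
  filter_upwards [(hf I).coeFn_toLp, (hg I).coeFn_toLp] with x h1 h2
  simp [toH, h1, h2, mul_comm]

lemma toH_surj (h : HS n) : ∃ (f : Coef n) (hf : ∀ I, MemLp (f I) 2), toH f hf = h := by
  refine ⟨fun I => (h I : (Fin n → ℝ) → ℝ), fun I => Lp.memLp (h I), ?_⟩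
  ext I : 1
  simp [toH]

lemma toH_norm (f : Coef n) (hf : ∀ I, MemLp (f I) 2) :
    ‖toH f hf‖ ^ 2 = ∑ I, ∫ x, f I x ^ 2 := by
  rw [← real_inner_self_eq_norm_sq, toH_inner]
  simp [pair, pow_two]

def TV (n : ℕ) : Submodule ℝ (Coef n) where
  carrier := {η | ∀ I, Tst (η I)}
  add_mem' := fun ha hb I => (ha I).add (hb I)
  zero_mem' := fun _ => Tst.zero
  smul_mem' := fun c _ h I => (h I).const_mul c

def jL (n : ℕ) : TV n →ₗ[ℝ] HS n where
  toFun η := toH η.1 fun I => (η.2 I).memLp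
  map_add' a b := by
    ext I : 1
    exact MemLp.toLp_add ((a.2 I).memLp) ((b.2 I).memLp)
  map_smul' c a := by
    ext I : 1
    exact MemLp.toLp_const_smul c ((a.2 I).memLp)

def DsL {φ : (Fin n → ℝ) → ℝ} (hφ : ContDiff ℝ (⊤ : ℕ∞) φ) : TV n →ₗ[ℝ] TV n where
  toFun η := ⟨Ds φ η.1, Tst.Ds hφ η.2⟩
  map_add' a b := by
    ext K x
    change Ds φ (a.1 + b.1) K x = Ds φ a.1 K x + Ds φ b.1 K x
    unfold Ds
    rw [← Finset.sum_add_distrib]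
    refine Finset.sum_congr rfl fun i _ => ?_
    rw [← mul_add, ← Bo_add (a.2 _).1 (b.2 _).1]
    rfl
  map_smul' c a := by
    ext K x
    change Ds φ (c • a.1) K x = c * Ds φ a.1 K x
    unfold Ds
    rw [Finset.mul_sum]
    refine Finset.sum_congr rfl fun i _ => ?_
    rw [mul_left_comm, ← Bo_const_mul (a.2 _).1]
    rfl

def Fs (M : Finset (Fin n)) (ψ : (Fin n → ℝ) → ℝ) : Coef n := fun I => if I = M then ψ else fun _ => 0

lemma Fs_tst (M : Finset (Fin n)) {ψ : (Fin n → ℝ) → ℝ} (hψ : Tst ψ) (I : Finset (Fin n)) :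
    Tst (Fs M ψ I) := by
  unfold Fs
  split_ifs
  · exact hψ
  · exact Tst.zero

lemma Bo_zero (φ : (Fin n → ℝ) → ℝ) (σ : ℝ) (i : Fin n) (x : Fin n → ℝ) :
    Bo φ σ i (fun _ => 0) x = 0 := by simp [Bo, pd]

lemma pair_Ds_Fs {φ : (Fin n → ℝ) → ℝ} (hφ : ContDiff ℝ (⊤ : ℕ∞) φ) {v : Coef n}
    (hv : ∀ I, MemLp (v I) 2) (M : Finset (Fin n)) {ψ : (Fin n → ℝ) → ℝ} (hψ : Tst ψ) :
    pair v (Ds φ (Fs M ψ)) = ∑ i, ∫ x, (ce i M * v (M.erase i) x) * Bo φ (-1) i ψ x := by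
  rw [pair_Ds hφ hv (Fs_tst M hψ), Finset.sum_eq_single M]
  · simp [Fs]
  · intro b _ hb
    simp [Fs, hb, Bo_zero]
  · simp

lemma pair_Dd_Fs {φ : (Fin n → ℝ) → ℝ} (hφ : ContDiff ℝ (⊤ : ℕ∞) φ) {v : Coef n}
    (hv : ∀ I, MemLp (v I) 2) (M : Finset (Fin n)) {ψ : (Fin n → ℝ) → ℝ} (hψ : Tst ψ) :
    pair v (Dd φ (Fs M ψ)) = ∑ i, ∫ x, (ca i M * v (insert i M) x) * Bo φ 1 i ψ x := by
  rw [pair_Dd hφ hv (Fs_tst M hψ), Finset.sum_eq_single M]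
  · simp [Fs]
  · intro b _ hb
    simp [Fs, hb, Bo_zero]
  · simp

lemma pair_Fs (v : Coef n) (M : Finset (Fin n)) (ψ : (Fin n → ℝ) → ℝ) :
    pair v (Fs M ψ) = ∫ x, v M x * ψ x := by
  unfold pair
  rw [Finset.sum_eq_single M]
  · simp [Fs]
  · intro b _ hb
    simp [Fs, hb]
  · simp

/-- The a priori estimate. -/
lemma apriori {φ : (Fin n → ℝ) → ℝ} (hφ : ContDiff ℝ (⊤ : ℕ∞) φ) (ε : ℝ) (hε : 0 < ε)
    (hHess : ∀ x, ((hessM n φ x) - ε • (1 : Matrix (Fin n) (Fin n) ℝ)).PosSemidef)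
    (p : ℕ) (hp : 1 ≤ p) (b : Coef n) (hb : ∀ I, MemLp (b I) 2)
    (hbp : ∀ I, I.card ≠ p → b I = fun _ => 0)
    (hbN : ∀ θ : Coef n, (∀ I, Tst (θ I)) → pair b (Ds φ θ) = 0) (η : TV n) :
    |inner ℝ (toH b hb) (jL n η)|
      ≤ (‖toH b hb‖ * Real.sqrt ((p : ℝ) * ε)⁻¹) * ‖jL n (DsL hφ η)‖ := by
  obtain ⟨R, hR⟩ : ∃ R : Submodule ℝ (HS n), R = LinearMap.range (jL n ∘ₗ DsL hφ) := ⟨_, rfl⟩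
  obtain ⟨N, hN⟩ : ∃ N : Submodule ℝ (HS n), N = Rᗮ := ⟨_, rfl⟩
  have memN : ∀ v (hv : ∀ I, MemLp (v I) 2), toH v hv ∈ N ↔
      ∀ θ : Coef n, (∀ I, Tst (θ I)) → pair v (Ds φ θ) = 0 := by
    intro v hv
    rw [hN, hR, Submodule.mem_orthogonal']
    constructor
    · intro h θ hθ
      have := h _ (LinearMap.mem_range_self (jL n ∘ₗ DsL hφ) ⟨θ, hθ⟩)
      rw [← this]
      exact (toH_inner v (Ds φ θ) hv fun I => (Tst.Ds hφ hθ I).memLp).symm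
    · rintro h _ ⟨θ, rfl⟩
      exact (toH_inner v (Ds φ θ.1) hv fun I => (Tst.Ds hφ θ.2 I).memLp).trans (h θ.1 θ.2)
  obtain ⟨w', hwN', horth⟩ := proj_ex R (jL n η)
  obtain ⟨w, hw, hwe⟩ := toH_surj w'
  have hwN : toH w hw ∈ N := by rw [hwe, hN]; exact hwN'
  have orth : ∀ v (hv : ∀ I, MemLp (v I) 2), toH v hv ∈ N → pair η.1 v = pair w v := by
    intro v hv h
    have := horth _ (hN ▸ h)
    rw [← hwe, toH_inner] at this
    have h2 : inner ℝ (jL n η) (toH v hv) = pair η.1 v := toH_inner _ _ _ _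
    linarith
  have hg : ∀ I, Tst (Ds φ η.1 I) := Tst.Ds hφ η.2
  have wb := weak_bochner hφ ε hHess w (Ds φ η.1) hw (fun I => (hg I).memLp)
    (by
      intro M ψ hψ
      rw [← pair_Ds_Fs hφ hw M hψ]
      exact (memN w hw).1 hwN _ (Fs_tst M hψ))
    (by
      intro K ψ hψ
      have hF := Fs_tst K hψ
      rw [← pair_Dd_Fs hφ hw K hψ, ← pair_Fs,
        ← orth _ (fun I => (Tst.Dd hφ hF I).memLp)]
      · exact pair_adj hφ η.2 hF
      · rw [memN]
        intro θ hθ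
        exact pair_Dd_Ds hφ hF hθ)
  -- restrict to degree p
  let wp : Coef n := fun I => if I.card = p then w I else fun _ => 0
  have hwp : ∀ I, MemLp (wp I) 2 := by
    intro I
    simp only [wp]
    split_ifs
    · exact hw I
    · exact MemLp.zero
  have hpe : (0:ℝ) < p * ε := by
    have : (0:ℝ) < p := by exact_mod_cast hp
    positivity
  have e1 : ‖toH wp hwp‖ ^ 2 ≤ (p * ε)⁻¹ * ‖jL n (DsL hφ η)‖ ^ 2 := by
    have e2 : ‖jL n (DsL hφ η)‖ ^ 2 = ∑ K, ∫ x, (Ds φ η.1 K x) ^ 2 :=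
      toH_norm (Ds φ η.1) fun I => (hg I).memLp
    rw [e2, toH_norm, inv_mul_eq_div, le_div_iff₀ hpe]
    refine le_trans ?_ wb
    rw [mul_comm, mul_comm (p:ℝ), mul_assoc, Finset.mul_sum]
    refine mul_le_mul_of_nonneg_left (Finset.sum_le_sum fun I _ => ?_) hε.le
    by_cases hI : I.card = p
    · simp [wp, hI]
    · simp only [wp, hI, if_false]
      have : 0 ≤ ∫ x, (w I x) ^ 2 := integral_nonneg fun x => sq_nonneg _
      simp only [ne_eq, OfNat.ofNat_ne_zero, not_false_eq_true, zero_pow, integral_zero, mul_zero]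
      positivity
  have e3 : inner ℝ (toH b hb) (jL n η) = inner ℝ (toH b hb) (toH wp hwp) := by
    have h1 : inner ℝ (jL n η) (toH b hb) = pair η.1 b := toH_inner _ _ _ _
    rw [real_inner_comm, h1, orth b hb ((memN b hb).2 hbN), toH_inner]
    refine Finset.sum_congr rfl fun I _ => ?_
    by_cases hI : I.card = p
    · simp [wp, hI, mul_comm]
    · simp [hbp I hI]
  rw [e3, mul_assoc]
  refine (abs_real_inner_le_norm _ _).trans ?_
  refine mul_le_mul_of_nonneg_left ?_ (norm_nonneg _)
  refine abs_le_of_sq_le_sq' ?_ (by positivity) |>.2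
  rw [mul_pow, Real.sq_sqrt (by positivity)]
  exact e1

end

section
variable {n : ℕ}

lemma smooth_exp {φ : (Fin n → ℝ) → ℝ} (hφ : ContDiff ℝ (⊤ : ℕ∞) φ) (c : ℝ) :
    ContDiff ℝ (⊤ : ℕ∞) (fun x => Real.exp (c * φ x)) :=
  Real.contDiff_exp.comp (contDiff_const.mul hφ)

lemma pd_exp {φ : (Fin n → ℝ) → ℝ} (hφ : ContDiff ℝ (⊤ : ℕ∞) φ) (c : ℝ) (i : Fin n)
    (x : Fin n → ℝ) :
    pd i (fun x => Real.exp (c * φ x)) x = Real.exp (c * φ x) * (c * pd i φ x) := by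
  have h := (((smooth_diff hφ x).hasFDerivAt.const_mul c).exp).fderiv
  unfold pd
  rw [h]
  simp

lemma Bo_exp {φ χ : (Fin n → ℝ) → ℝ} (hφ : ContDiff ℝ (⊤ : ℕ∞) φ) (hχ : Tst χ) (i : Fin n)
    (x : Fin n → ℝ) :
    Bo φ (-1) i (fun x => Real.exp (1 / 2 * φ x) * χ x) x
      = - (Real.exp (1 / 2 * φ x) * pd i χ x) := by
  rw [Bo, pd_mul (smooth_exp hφ _) hχ.1, pd_exp hφ]
  ring

lemma pd_expm {φ ψ : (Fin n → ℝ) → ℝ} (hφ : ContDiff ℝ (⊤ : ℕ∞) φ) (hψ : Tst ψ) (i : Fin n)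
    (x : Fin n → ℝ) :
    pd i (fun x => Real.exp (-(1 / 2) * φ x) * ψ x) x
      = - (Real.exp (-(1 / 2) * φ x) * Bo φ (-1) i ψ x) := by
  rw [pd_mul (smooth_exp hφ _) hψ.1, pd_exp hφ, Bo]
  ring

lemma sum_ce (M : Finset (Fin n)) (F : Fin n → ℝ) :
    ∑ i, ce i M * F i = ∑ i ∈ M, (-1 : ℝ) ^ (M.filter (· < i)).card * F i := by
  rw [← Finset.sum_subset (Finset.subset_univ M)]
  · refine Finset.sum_congr rfl fun i hi => ?_
    simp [ce, hi, sg]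
  · intro i _ hi
    simp [ce, hi]

lemma exp_sq1 (t b : ℝ) : (Real.exp (-(1 / 2) * t) * b) ^ 2 = b ^ 2 * Real.exp (-t) := by
  rw [mul_pow, ← Real.exp_nat_mul, mul_comm]
  congr 2
  push_cast
  ring

lemma exp_sq2 (t b : ℝ) : (Real.exp (1 / 2 * t) * b) ^ 2 * Real.exp (-t) = b ^ 2 := by
  rw [mul_pow, ← Real.exp_nat_mul, mul_right_comm, ← Real.exp_add]
  have : (2 : ℕ) * (1 / 2 * t) + -t = 0 := by push_cast; ring
  rw [this, Real.exp_zero, one_mul]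
end

/-- let `ε > 0` and `φ` smooth with `Hess φ(x) − ε·Id` positive
semidefinite everywhere. If `β` is a `d`-closed `(p,n)`-super form (`1 ≤ p ≤ n`) with
locally integrable coefficients and `Σ_I ∫ β_I² e^{−φ} < ∞`, then there is a
`(p−1,n)`-super form `α` with locally integrable coefficients, `dα = β` in the sense of
distributions, and `Σ_K ∫ α_K² e^{−φ} ≤ (pε)⁻¹ Σ_I ∫ β_I² e^{−φ}`. (A `(p,n)`-form
`Σ β_I dx_I ∧ dξ` is recorded by its coefficient family, on which `d` acts exactly as
on `p`-forms; the norms are with respect to the flat metric.) -/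
theorem dbar_solution_with_weight (n : ℕ) (hn : 1 ≤ n)
    (ε : ℝ) (hε : 0 < ε)
    (φ : (Fin n → ℝ) → ℝ) (hφ : ContDiff ℝ (⊤ : ℕ∞) φ)
    (hHess : ∀ x, ((hessM n φ x) - ε • (1 : Matrix (Fin n) (Fin n) ℝ)).PosSemidef)
    (p : ℕ) (hp : 1 ≤ p) (hpn : p ≤ n)
    (β : Coef n)
    (hloc : ∀ I : Finset (Fin n), I.card = p → LocallyIntegrable (β I))
    (hL2 : ∀ I : Finset (Fin n), I.card = p →
      Integrable fun x : Fin n → ℝ => (β I x) ^ 2 * Real.exp (-φ x))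
    (hdβ : IsDistDeriv n p β fun _ _ => 0) :
    ∃ α : Coef n,
      (∀ K : Finset (Fin n), K.card = p - 1 → LocallyIntegrable (α K)) ∧
      (∀ K : Finset (Fin n), K.card = p - 1 →
        Integrable fun x : Fin n → ℝ => (α K x) ^ 2 * Real.exp (-φ x)) ∧
      IsDistDeriv n (p - 1) α β ∧
      (∑ K ∈ Finset.univ.filter (fun K : Finset (Fin n) => K.card = p - 1),
          ∫ x : Fin n → ℝ, (α K x) ^ 2 * Real.exp (-φ x))
        ≤ ((p : ℝ) * ε)⁻¹ *
          ∑ I ∈ Finset.univ.filter (fun I : Finset (Fin n) => I.card = p),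
            ∫ x : Fin n → ℝ, (β I x) ^ 2 * Real.exp (-φ x) := by
  classical
  let b : Coef n := fun I => if I.card = p then fun x => Real.exp (-(1 / 2) * φ x) * β I x
    else fun _ => 0
  have b1 : ∀ I, I.card = p → b I = fun x => Real.exp (-(1 / 2) * φ x) * β I x := by
    intro I hI
    simp [b, hI]
  have b2 : ∀ I, I.card ≠ p → b I = fun _ => 0 := by
    intro I hI
    simp [b, hI]
  have hb : ∀ I, MemLp (b I) 2 := by
    intro I
    by_cases hI : I.card = p
    · rw [b1 I hI]
      have hm : AEStronglyMeasurable (fun x => Real.exp (-(1 / 2) * φ x) * β I x) volume :=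
        (smooth_exp hφ (-(1 / 2))).continuous.aestronglyMeasurable.mul
          (hloc I hI).aestronglyMeasurable
      rw [memLp_two_iff_integrable_sq hm]
      refine (hL2 I hI).congr (Filter.Eventually.of_forall fun x => ?_)
      exact (exp_sq1 _ _).symm
    · rw [b2 I hI]
      exact MemLp.zero
  have hbN : ∀ θ : Coef n, (∀ I, Tst (θ I)) → pair b (Ds φ θ) = 0 := by
    intro θ hθ
    rw [pair_Ds hφ hb hθ]
    refine Finset.sum_eq_zero fun M _ => ?_
    simp_rw [mul_assoc, integral_const_mul]
    rw [sum_ce]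
    by_cases hM : M.card = p + 1
    · have hT : Tst (fun x => Real.exp (-(1 / 2) * φ x) * θ M x) :=
        Tst.mul (smooth_exp hφ _) (hθ M)
      have h := hdβ M hM _ hT.1 hT.2
      simp only [zero_mul, integral_zero] at h
      refine Eq.trans ?_ h.symm
      rw [← Finset.sum_neg_distrib]
      refine Finset.sum_congr rfl fun i hi => ?_
      have hc : (M.erase i).card = p := by
        rw [Finset.card_erase_of_mem hi, hM]
        omega
      rw [← mul_neg, ← integral_neg, b1 _ hc]
      congr 2
      ext x
      have := pd_expm hφ (hθ M) i x
      rw [pd] at this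
      rw [this]
      ring
    · refine Finset.sum_eq_zero fun i hi => ?_
      have : (M.erase i).card ≠ p := by
        rw [Finset.card_erase_of_mem hi]
        have := Finset.card_pos.2 ⟨i, hi⟩
        omega
      simp [b2 _ this]
  obtain ⟨a, han, ha⟩ := hilb (jL n ∘ₗ DsL hφ)
    ((innerSL ℝ (toH b hb)).toLinearMap ∘ₗ jL n) (‖toH b hb‖ * Real.sqrt ((p : ℝ) * ε)⁻¹)
    (by positivity) (fun η => apriori hφ ε hε hHess p hp b hb b2 hbN η)
  obtain ⟨u, hu, rfl⟩ := toH_surj a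
  have key : ∀ η : Coef n, (∀ I, Tst (η I)) → pair u (Ds φ η) = pair b η := by
    intro η hη
    have h1 := ha ⟨η, hη⟩
    have h2 := toH_inner u (Ds φ η) hu fun I => (Tst.Ds hφ hη I).memLp
    have h3 := toH_inner b η hb fun I => (hη I).memLp
    exact h2.symm.trans (h1.trans h3)
  refine ⟨fun K x => Real.exp (1 / 2 * φ x) * u K x, ?_, ?_, ?_, ?_⟩
  · intro K _
    have h0 : LocallyIntegrableOn (u K) Set.univ := (memLp_loc (hu K)).locallyIntegrableOn _
    have h1 := h0.continuousOn_mul (smooth_exp hφ (1 / 2)).continuous.continuousOn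
      isOpen_univ.isLocallyClosed
    exact locallyIntegrableOn_univ.1 h1
  · intro K _
    simp_rw [exp_sq2]
    exact memLp_sq_int (hu K)
  · intro M hM χ hχ1 hχ2
    have hχ : Tst χ := ⟨hχ1, hχ2⟩
    have hψ : Tst (fun x => Real.exp (1 / 2 * φ x) * χ x) := Tst.mul (smooth_exp hφ _) hχ
    have h := key _ (Fs_tst M hψ)
    rw [pair_Fs, pair_Ds_Fs hφ hu M hψ] at h
    have hMp : M.card = p := by omega
    have e1 : ∫ x, b M x * (Real.exp (1 / 2 * φ x) * χ x) = ∫ x, β M x * χ x := by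
      congr 1
      ext x
      rw [b1 M hMp]
      have : Real.exp (-(1 / 2) * φ x) * Real.exp (1 / 2 * φ x) = 1 := by
        rw [← Real.exp_add, ← Real.exp_zero]
        congr 1
        ring
      linear_combination (β M x * χ x) * this
    rw [← e1, ← h, ← sum_ce M (fun i => ∫ x, Real.exp (1 / 2 * φ x) * u (M.erase i) x
      * fderiv ℝ χ x (Pi.single i 1)), ← Finset.sum_neg_distrib]
    refine Finset.sum_congr rfl fun i _ => ?_
    rw [← mul_neg, ← integral_neg, ← integral_const_mul]
    congr 1
    ext x
    rw [Bo_exp hφ hχ, pd]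
    ring
  · simp_rw [exp_sq2]
    have hpe : (0:ℝ) ≤ (p * ε)⁻¹ := by positivity
    have e1 : ‖toH u hu‖ ^ 2 ≤ ((p : ℝ) * ε)⁻¹ * ‖toH b hb‖ ^ 2 := by
      have := pow_le_pow_left₀ (norm_nonneg _) han 2
      rwa [mul_pow, Real.sq_sqrt hpe, mul_comm] at this
    rw [toH_norm, toH_norm] at e1
    have e2 : ∑ I, ∫ x, b I x ^ 2 = ∑ I ∈ Finset.univ.filter (fun I : Finset (Fin n) => I.card = p),
            ∫ x : Fin n → ℝ, (β I x) ^ 2 * Real.exp (-φ x) := by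
      rw [Finset.sum_filter]
      refine Finset.sum_congr rfl fun I _ => ?_
      split_ifs with hI
      · rw [b1 I hI]
        simp_rw [exp_sq1]
      · simp [b2 I hI]
    rw [← e2]
    refine le_trans ?_ e1
    exact Finset.sum_le_sum_of_subset_of_nonneg (Finset.filter_subset _ _)
      fun K _ _ => integral_nonneg fun x => sq_nonneg _
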